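/- arXiv:1008.3475 — 2 statements merged into one kernel-verified Lean document; each statement's English description precedes it below -/
import Mathlib

section
/- For all integers n ≥ 0, (-1)^n · ped(3n+1) ≡ p̄_o(48n+18) (mod 3). -/
/-- `ped n`: number of partitions of `n` in which even parts are not repeated. -/
noncomputable def ped (n : ℕ) : ℕ :=
  Nat.card {p : n.Partition // ∀ i, Even i → p.parts.count i ≤ 1}

/-- Number of overpartitions of `n` into odd parts: pairs consisting of a
partition of some `m ≤ n` into distinct odd parts (the overlined parts)
and a partition of `n - m` into odd parts. -/
def pbarOdd (n : ℕ) : ℕ :=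
  ∑ m ∈ Finset.range (n + 1),
    (Nat.Partition.oddDistincts m).card * (Nat.Partition.odds (n - m)).card

section PedPbarOdd

open PowerSeries PowerSeries.WithPiTopology

/-- Combining the products over the fibres of a finite partition of the index type. -/
theorem HasProd.of_fintype_prod {ι κ τ M : Type*} [Fintype τ] [CommMonoid M] [TopologicalSpace M]
    [ContinuousMul M] (e : ι ≃ κ × τ) {f : ι → M} {a : τ → M}
    (h : ∀ r, HasProd (fun k ↦ f (e.symm (k, r))) (a r)) : HasProd f (∏ r, a r) := by
  classical
  rw [← e.symm.hasProd_iff]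
  have key : f ∘ e.symm = fun p ↦ ∏ r, if p.2 = r then f (e.symm p) else 1 := by
    ext p
    simp
  rw [key]
  refine hasProd_prod fun r _ ↦ ?_
  have inj : Function.Injective fun k : κ ↦ (k, r) := fun a b hab ↦ congrArg Prod.fst hab
  rw [← inj.hasProd_iff]
  · simpa [Function.comp_def] using h r
  · rintro ⟨k, s⟩ hk
    rw [if_neg]
    rintro rfl
    exact hk ⟨k, rfl⟩

/-- Combining the sums over the fibres of a finite partition of the index type. -/
theorem HasSum.of_fintype_prod {ι κ τ M : Type*} [Fintype τ] [AddCommMonoid M] [TopologicalSpace M]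
    [ContinuousAdd M] (e : ι ≃ κ × τ) {f : ι → M} {a : τ → M}
    (h : ∀ r, HasSum (fun k ↦ f (e.symm (k, r))) (a r)) : HasSum f (∑ r, a r) :=
  HasProd.of_fintype_prod (M := Multiplicative M) e h

/-- The triangular number `j (j + 1) / 2` of an integer. -/
def tri (j : ℤ) : ℕ := (j * (j + 1) / 2).toNat

theorem two_mul_tri (j : ℤ) : 2 * (tri j : ℤ) = j * (j + 1) := by
  have h1 : 2 ∣ j * (j + 1) := (Int.even_mul_succ_self j).two_dvd
  have h2 : 0 ≤ j * (j + 1) := by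
    rcases le_or_gt 0 j with h | h
    · positivity
    · exact mul_nonneg_of_nonpos_of_nonpos (by lia) (by lia)
  rw [tri, Int.toNat_of_nonneg (Int.ediv_nonneg h2 (by norm_num))]
  lia

theorem tri_neg (j : ℤ) : tri (-j) = tri (j - 1) := by
  rw [tri, tri]
  congr 2
  ring

/-- The term `x ^ (j (j + 1) / 2) * y ^ (j (j - 1) / 2)` of Ramanujan's theta function. -/
def thetaTerm {A : Type*} [Monoid A] (x y : A) (j : ℤ) : A := x ^ tri j * y ^ tri (j - 1)

theorem thetaTerm_neg {A : Type*} [CommMonoid A] (x y : A) (j : ℤ) :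
    thetaTerm x y (-j) = thetaTerm y x j := by
  rw [thetaTerm, thetaTerm, tri_neg, show -j - 1 = -(j + 1) by ring, tri_neg, mul_comm]
  simp

theorem mul_thetaTerm_sub_one {A : Type*} [CommMonoid A] (x y : A) {m : ℕ} {j : ℤ}
    (hj : j ≤ m + 1) :
    x * (x * y) ^ m * thetaTerm x y (j - 1) = (x * y) ^ (m + 1 - j).toNat * thetaTerm x y j := by
  have e1 := two_mul_tri j
  have e2 := two_mul_tri (j - 1)
  have e3 := two_mul_tri (j - 1 - 1)
  have e4 : 1 + m + tri (j - 1) = (m + 1 - j).toNat + tri j := by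
    zify
    rw [Int.toNat_of_nonneg (by lia)]
    linarith
  have e5 : m + tri (j - 1 - 1) = (m + 1 - j).toNat + tri (j - 1) := by
    zify
    rw [Int.toNat_of_nonneg (by lia)]
    linarith
  calc x * (x * y) ^ m * thetaTerm x y (j - 1)
      = x ^ (1 + m + tri (j - 1)) * y ^ (m + tri (j - 1 - 1)) := by
        simp only [thetaTerm, mul_pow, pow_add, pow_one]
        ac_rfl
    _ = _ := by
        rw [e4, e5]
        simp only [thetaTerm, mul_pow, pow_add]
        ac_rfl

section FiniteJacobi

variable {A : Type*} [CommRing A] {u : ℤ → A}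

/-- The coefficient of `thetaTerm x y j` in the finite Jacobi triple product with `q = x y`, where
`u k` stands for the inverse of `(1 - q) ⋯ (1 - q ^ k)`. -/
def finiteJacobiTerm (u : ℤ → A) (x y : A) (m n : ℕ) (j : ℤ) : A :=
  (∏ i ∈ Finset.range (m + n), (1 - (x * y) ^ (i + 1))) * (u (n + j) * u (m - j)) *
    thetaTerm x y j

theorem finiteJacobiTerm_neg (x y : A) (m n : ℕ) (j : ℤ) :
    finiteJacobiTerm u x y m n (-j) = finiteJacobiTerm u y x n m j := by
  rw [finiteJacobiTerm, finiteJacobiTerm, thetaTerm_neg, add_comm m n, mul_comm x y,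
    mul_comm (u _), sub_neg_eq_add, ← sub_eq_add_neg]

theorem finiteJacobiTerm_succ (x y : A) (hneg : ∀ k < 0, u k = 0)
    (hu : ∀ k : ℕ, u k = u (k + 1) * (1 - (x * y) ^ (k + 1))) (m n : ℕ) (j : ℤ) :
    finiteJacobiTerm u x y (m + 1) n j = finiteJacobiTerm u x y m n j +
      x * (x * y) ^ m * finiteJacobiTerm u x y m n (j - 1) := by
  have hu' : ∀ k : ℤ, 0 ≤ k → u (k - 1) = u k * (1 - (x * y) ^ k.toNat) := by
    intro k hk
    obtain ⟨k, rfl⟩ := Int.eq_ofNat_of_zero_le hk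
    rcases k with _ | k
    · simp [hneg]
    · simpa using hu k
  simp only [finiteJacobiTerm]
  rcases lt_or_ge (m + 1 : ℤ) j with hj | hj
  · rw [hneg (↑(m + 1) - j) (by push_cast; lia), hneg (m - j) (by lia),
      hneg (m - (j - 1)) (by lia)]
    simp
  rcases lt_or_ge (n + j) 0 with hj' | hj'
  · rw [hneg (n + j) hj', hneg (n + (j - 1)) (by lia)]
    simp
  have h1 := hu' (m + 1 - j) (by lia)
  have h2 := hu' (n + j) hj'
  have h3 : (m + 1 - j).toNat + (n + j).toNat = m + n + 1 := by lia
  rw [mul_left_comm (x * (x * y) ^ m), mul_thetaTerm_sub_one x y hj,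
    show (m - j : ℤ) = m + 1 - j - 1 by ring, h1, show (n + (j - 1) : ℤ) = n + j - 1 by ring, h2,
    show (m - (j - 1) : ℤ) = m + 1 - j by ring, show m + 1 + n = m + n + 1 by ring,
    Finset.prod_range_succ, ← h3, pow_add]
  push_cast
  ring

variable [TopologicalSpace A] [IsTopologicalRing A]

theorem HasSum.finiteJacobiTerm_succ {x y : A} (hneg : ∀ k < 0, u k = 0)
    (hu : ∀ k : ℕ, u k = u (k + 1) * (1 - (x * y) ^ (k + 1))) {m n : ℕ} {s : A}
    (h : HasSum (finiteJacobiTerm u x y m n) s) :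
    HasSum (finiteJacobiTerm u x y (m + 1) n) (s * (1 + x * (x * y) ^ m)) := by
  have h' := ((Equiv.subRight (1 : ℤ)).hasSum_iff.mpr h).mul_left (x * (x * y) ^ m)
  convert! h.add h' using 1
  · ext j
    exact _root_.finiteJacobiTerm_succ x y hneg hu m n j
  · ring

/-- The finite form of the Jacobi triple product identity. -/
theorem hasSum_finiteJacobiTerm (x y : A) (h0 : u 0 = 1) (hneg : ∀ k < 0, u k = 0)
    (hu : ∀ k : ℕ, u k = u (k + 1) * (1 - (x * y) ^ (k + 1))) (m n : ℕ) :
    HasSum (finiteJacobiTerm u x y m n)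
      ((∏ k ∈ Finset.range m, (1 + x * (x * y) ^ k)) *
        ∏ k ∈ Finset.range n, (1 + y * (x * y) ^ k)) := by
  induction n with
  | zero =>
    induction m with
    | zero =>
      have key : HasSum (finiteJacobiTerm u x y 0 0) (finiteJacobiTerm u x y 0 0 0) := by
        refine hasSum_single 0 fun j hj ↦ ?_
        rcases lt_or_gt_of_ne hj with hj | hj
        · simp [finiteJacobiTerm, hneg j hj]
        · simp [finiteJacobiTerm, hneg (-j) (by lia)]
      simpa [finiteJacobiTerm, thetaTerm, tri, h0] using key
    | succ m ih =>
      rw [Finset.prod_range_succ, mul_right_comm]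
      exact ih.finiteJacobiTerm_succ hneg hu
  | succ n ih =>
    rw [Finset.prod_range_succ, ← mul_assoc, ← (Equiv.neg ℤ).hasSum_iff]
    rw [← (Equiv.neg ℤ).hasSum_iff] at ih
    simp only [Function.comp_def, Equiv.neg_apply, finiteJacobiTerm_neg] at ih ⊢
    simp only [mul_comm x y] at hu ih ⊢
    exact ih.finiteJacobiTerm_succ hneg hu

end FiniteJacobi

section JacobiTripleProduct

variable {R : Type*} [CommRing R] [TopologicalSpace R] [DiscreteTopology R]

theorem HasProd.eventually_X_pow_dvd_sub {g : ℕ → R⟦X⟧} {c : R⟦X⟧} (h : HasProd g c) (d : ℕ) :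
    ∀ᶠ m in Filter.atTop, X ^ d ∣ c - ∏ i ∈ Finset.range m, g i := by
  have h' := (tendsto_iff_coeff_tendsto _ _ _ _).mp h.tendsto_prod_nat
  simp only [nhds_discrete, Filter.tendsto_pure] at h'
  filter_upwards [(Finset.range d).eventually_all.mpr fun i _ ↦ h' i] with m hm
  rw [X_pow_dvd_iff]
  intro i hi
  rw [map_sub, hm i (Finset.mem_range.mpr hi), sub_self]

/-- **Jacobi's triple product identity** for power series, in Ramanujan's form. -/
theorem hasSum_thetaTerm {x y a b c : R⟦X⟧} (hy : X ∣ y)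
    (ha : HasProd (fun k : ℕ ↦ 1 + x * (x * y) ^ k) a)
    (hb : HasProd (fun k : ℕ ↦ 1 + y * (x * y) ^ k) b)
    (hc : HasProd (fun k : ℕ ↦ 1 - (x * y) ^ (k + 1)) c) :
    HasSum (thetaTerm x y) (a * b * c) := by
  set Q : ℕ → R⟦X⟧ := fun k ↦ ∏ i ∈ Finset.range k, (1 - (x * y) ^ (i + 1)) with hQ
  have hq : constantCoeff (x * y) = 0 := by
    rw [← X_dvd_iff]
    exact hy.mul_left x
  have hQu : ∀ k, IsUnit (Q k) := by
    intro k
    simp [isUnit_iff_constantCoeff, hQ, hq]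
  set u : ℤ → R⟦X⟧ := fun k ↦ if k < 0 then 0 else Ring.inverse (Q k.toNat) with hu
  have huQ : ∀ k : ℤ, 0 ≤ k → u k * Q k.toNat = 1 := by
    intro k hk
    simp only [hu, if_neg hk.not_gt]
    exact Ring.inverse_mul_cancel _ (hQu _)
  have hsucc : ∀ k : ℕ, u k = u (k + 1) * (1 - (x * y) ^ (k + 1)) := by
    intro k
    apply (hQu k).mul_right_cancel
    have h1 := huQ k (by lia)
    have h2 := huQ (k + 1) (by lia)
    have h3 : ((k : ℤ) + 1).toNat = k + 1 := by lia
    rw [h3] at h2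
    simp only [Int.toNat_natCast] at h1
    have h4 : Q (k + 1) = Q k * (1 - (x * y) ^ (k + 1)) := Finset.prod_range_succ _ _
    rw [h4] at h2
    rw [h1]
    linear_combination -h2
  rw [hasSum_iff_hasSum_coeff]
  intro d
  obtain ⟨N, hN⟩ := Filter.eventually_atTop.mp ((ha.eventually_X_pow_dvd_sub (d + 1)).and
    ((hb.eventually_X_pow_dvd_sub (d + 1)).and (hc.eventually_X_pow_dvd_sub (d + 1))))
  have key := (hasSum_finiteJacobiTerm x y (u := u) (by simp [hu, hQ])
    (fun k hk ↦ by simp [hu, hk]) hsucc (N + d + 1) (N + d + 1)).mul_left c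
  rw [hasSum_iff_hasSum_coeff] at key
  have coeff_eq : ∀ {f g : R⟦X⟧}, X ^ (d + 1) ∣ f - g → coeff d f = coeff d g := by
    intro f g hfg
    rw [← sub_eq_zero, ← map_sub]
    exact X_pow_dvd_iff.mp hfg d (Nat.lt_succ_self d)
  convert! key d using 1
  · ext j
    apply coeff_eq
    by_cases hj : d < tri (j - 1)
    · have : X ^ (d + 1) ∣ thetaTerm x y j :=
        (pow_dvd_pow _ hj).trans ((pow_dvd_pow_of_dvd hy _).mul_left _)
      exact dvd_sub this ((this.mul_left _).mul_left _)
    · have htri := two_mul_tri (j - 1)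
      have hj1 : j ≤ d + 1 := by nlinarith
      have hj2 : -(d + 1 : ℤ) ≤ j := by nlinarith
      have h1 := huQ (↑(N + d + 1) + j) (by push_cast; lia)
      have h2 := huQ (↑(N + d + 1) - j) (by push_cast; lia)
      have d1 := (hN (↑(N + d + 1) + j).toNat (by push_cast; lia)).2.2
      have d2 := (hN (↑(N + d + 1) - j).toNat (by push_cast; lia)).2.2
      have d3 := (hN (N + d + 1 + (N + d + 1)) (by lia)).2.2
      simp only [finiteJacobiTerm]
      generalize u (↑(N + d + 1) + j) = u₁ at *
      generalize u (↑(N + d + 1) - j) = u₂ at *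
      change _ ∣ c - Q _ at d1 d2 d3
      change _ ∣ _ - c * (Q _ * _ * _)
      generalize Q (↑(N + d + 1) + j).toNat = Q₁ at *
      generalize Q (↑(N + d + 1) - j).toNat = Q₂ at *
      generalize Q (N + d + 1 + (N + d + 1)) = Q₃ at *
      have : thetaTerm x y j - c * (Q₃ * (u₁ * u₂) * thetaTerm x y j) =
          (c - Q₃) * (c * u₁ * u₂ * thetaTerm x y j) - (c - Q₁) * (c * u₁ * u₂ * thetaTerm x y j)
            - (c - Q₂) * (Q₁ * u₁ * u₂ * thetaTerm x y j) := by
        linear_combination (-(u₂ * Q₂) * thetaTerm x y j) * h1 - thetaTerm x y j * h2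
      rw [this]
      exact dvd_sub (dvd_sub (d3.mul_right _) (d1.mul_right _)) (d2.mul_right _)
  · apply coeff_eq
    obtain ⟨d1, d2, -⟩ := hN (N + d + 1) (by lia)
    generalize (∏ k ∈ Finset.range (N + d + 1), (1 + x * (x * y) ^ k)) = a' at *
    generalize (∏ k ∈ Finset.range (N + d + 1), (1 + y * (x * y) ^ k)) = b' at *
    rw [show a * b * c - c * (a' * b') = (a - a') * (b * c) + (b - b') * (a' * c) by ring]
    exact dvd_add (d1.mul_right _) (d2.mul_right _)

end JacobiTripleProduct

section Dilate

variable {R : Type*} [CommRing R]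

/-- The substitution `X ↦ X ^ k` on power series. -/
noncomputable def dilate (k : ℕ) [NeZero k] : R⟦X⟧ →ₐ[R] R⟦X⟧ := expand k (NeZero.ne k)

@[simp]
theorem dilate_X (k : ℕ) [NeZero k] : dilate k (X : R⟦X⟧) = X ^ k := expand_X k _

theorem dilate_dilate (j k l : ℕ) [NeZero j] [NeZero k] [NeZero l] (h : j * k = l) (F : R⟦X⟧) :
    dilate j (dilate k F) = dilate l F := by
  subst h
  exact (expand_mul j _ k _ F).symm

theorem coeff_dilate (k : ℕ) [NeZero k] (F : R⟦X⟧) (n : ℕ) :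
    coeff n (dilate k F) = if k ∣ n then coeff (n / k) F else 0 := coeff_expand k _ F

theorem coeff_mul_add_X_pow_mul_dilate {k s r : ℕ} [NeZero k] (hs : s < k) (hr : r < k)
    (F : R⟦X⟧) (n : ℕ) :
    coeff (k * n + r) (X ^ s * dilate k F) = if r = s then coeff n F else 0 := by
  have hk : 0 < k := by lia
  rw [coeff_X_pow_mul', coeff_dilate]
  by_cases h : r = s
  · subst h
    simp [hk]
  rw [if_neg h]
  split_ifs with h1 h2
  · obtain ⟨m, hm⟩ := h2
    exfalso
    apply h
    have h3 : k * n + r = k * m + s := by lia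
    simpa [Nat.add_mod, Nat.mod_eq_of_lt hr, Nat.mod_eq_of_lt hs] using congrArg (· % k) h3
  · rfl
  · rfl

theorem rescale_neg_one_dilate (k : ℕ) [NeZero k] (hk : Even k) (F : R⟦X⟧) :
    rescale (-1) (dilate k F) = dilate k F := by
  ext n
  rw [coeff_rescale, coeff_dilate]
  split_ifs with h
  · rw [(hk.trans_dvd h).neg_one_pow, one_mul]
  · simp

/-- A power series fixed by a dilation is constant. -/
theorem eq_C_of_dilate_eq {k : ℕ} [NeZero k] (hk : 2 ≤ k) {F : R⟦X⟧} (h : dilate k F = F) :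
    F = C (constantCoeff F) := by
  ext n
  induction n using Nat.strong_induction_on with
  | _ n ih =>
    rcases Nat.eq_zero_or_pos n with rfl | hn
    · simp
    rw [← h, coeff_dilate, coeff_C, if_neg hn.ne']
    split_ifs with hd
    · have hlt : n / k < n := Nat.div_lt_self hn hk
      have hpos : n / k ≠ 0 := (Nat.div_pos (Nat.le_of_dvd hn hd) (by lia)).ne'
      rw [ih _ hlt, coeff_C, if_neg hpos]
    · rfl

variable [TopologicalSpace R]

theorem PowerSeries.WithPiTopology.continuous_of_coeff {T : Type*} [TopologicalSpace T]
    {g : T → R⟦X⟧} (h : ∀ n, Continuous fun t ↦ coeff n (g t)) : Continuous g := by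
  rw [continuous_iff_continuousAt]
  intro t
  rw [ContinuousAt, tendsto_iff_coeff_tendsto]
  exact fun n ↦ (h n).continuousAt

theorem continuous_dilate (k : ℕ) [NeZero k] : Continuous (dilate k : R⟦X⟧ → R⟦X⟧) := by
  refine continuous_of_coeff fun n ↦ ?_
  simp only [coeff_dilate]
  split_ifs
  · exact continuous_coeff R _
  · exact continuous_const

theorem continuous_rescale [ContinuousMul R] (a : R) :
    Continuous (rescale a : R⟦X⟧ → R⟦X⟧) := by
  refine continuous_of_coeff fun n ↦ ?_
  simp only [coeff_rescale]
  exact continuous_const.mul (continuous_coeff R _)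

end Dilate

section InfiniteProducts

variable {R : Type*} [CommRing R] [TopologicalSpace R]

theorem multipliable_one_add_of_X_pow_dvd {c : ℕ → R⟦X⟧} (h : ∀ n, X ^ n ∣ c n) :
    Multipliable fun n ↦ 1 + c n := by
  nontriviality R
  apply multipliable_one_add_of_tendsto_order_atTop_nhds_top
  refine ENat.tendsto_nhds_top_iff_natCast_lt.mpr (fun n ↦ Filter.eventually_atTop.mpr ⟨n + 1, ?_⟩)
  intro m hm
  refine lt_of_lt_of_le ?_
    (le_order (c m) m fun i hi ↦ X_pow_dvd_iff.mp (h m) i (by exact_mod_cast hi))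
  exact_mod_cast hm

variable (R) in
/-- The Euler product `∏ (1 - X ^ (n + 1))`. -/
noncomputable def eulerProd : R⟦X⟧ := ∏' n : ℕ, (1 - X ^ (n + 1))

variable (R) in
/-- The product `∏ (1 - X ^ (2 n + 1))`. -/
noncomputable def oddProd : R⟦X⟧ := ∏' n : ℕ, (1 - X ^ (2 * n + 1))

variable (R) in
/-- The generating function `∏ (1 + X ^ (n + 1))` of partitions into distinct parts. -/
noncomputable def distinctProd : R⟦X⟧ := ∏' n : ℕ, (1 + X ^ (n + 1))

theorem hasProd_eulerProd : HasProd (fun n : ℕ ↦ 1 - X ^ (n + 1)) (eulerProd R) :=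
  (multipliable_one_sub_X_pow R).hasProd

theorem hasProd_oddProd : HasProd (fun n : ℕ ↦ 1 - X ^ (2 * n + 1)) (oddProd R) := by
  refine Multipliable.hasProd ?_
  simp only [sub_eq_add_neg]
  exact multipliable_one_add_of_X_pow_dvd fun n ↦ (pow_dvd_pow X (by lia)).neg_right

theorem hasProd_distinctProd : HasProd (fun n : ℕ ↦ 1 + X ^ (n + 1)) (distinctProd R) :=
  (multipliable_one_add_of_X_pow_dvd fun n ↦ pow_dvd_pow X (by lia)).hasProd

theorem hasProd_dilate_eulerProd (k : ℕ) [NeZero k] :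
    HasProd (fun n : ℕ ↦ 1 - X ^ (k * (n + 1))) (dilate k (eulerProd R)) := by
  simpa [Function.comp_def, ← pow_mul] using
    (hasProd_eulerProd (R := R)).map (dilate k) (continuous_dilate k)

theorem hasProd_dilate_distinctProd (k : ℕ) [NeZero k] :
    HasProd (fun n : ℕ ↦ 1 + X ^ (k * (n + 1))) (dilate k (distinctProd R)) := by
  simpa [Function.comp_def, ← pow_mul] using
    (hasProd_distinctProd (R := R)).map (dilate k) (continuous_dilate k)

theorem hasProd_dilate_oddProd (k : ℕ) [NeZero k] :
    HasProd (fun n : ℕ ↦ 1 - X ^ (k * (2 * n + 1))) (dilate k (oddProd R)) := by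
  simpa [Function.comp_def, ← pow_mul] using
    (hasProd_oddProd (R := R)).map (dilate k) (continuous_dilate k)

variable [DiscreteTopology R]

theorem hasProd_rescale_oddProd :
    HasProd (fun n : ℕ ↦ 1 + X ^ (2 * n + 1)) (rescale (-1) (oddProd R)) := by
  have h := hasProd_oddProd.map (rescale (-1 : R)) (continuous_rescale (-1))
  simpa [Function.comp_def, rescale_neg_one_X, (odd_two_mul_add_one _).neg_pow] using h

theorem eulerProd_eq : eulerProd R = oddProd R * dilate 2 (eulerProd R) := by
  refine hasProd_eulerProd.unique ?_
  refine HasProd.even_mul_odd hasProd_oddProd ?_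
  convert! hasProd_dilate_eulerProd (R := R) 2 using 2

theorem oddProd_mul_rescale : oddProd R * rescale (-1) (oddProd R) = dilate 2 (oddProd R) := by
  refine (hasProd_oddProd.mul hasProd_rescale_oddProd).unique ?_
  convert! hasProd_dilate_oddProd (R := R) 2 using 2 with n
  ring

theorem eulerProd_mul_distinctProd :
    eulerProd R * distinctProd R = dilate 2 (eulerProd R) := by
  refine (hasProd_eulerProd.mul hasProd_distinctProd).unique ?_
  convert! hasProd_dilate_eulerProd (R := R) 2 using 2 with n
  ring

theorem constantCoeff_eulerProd : constantCoeff (eulerProd R) = 1 := by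
  have h := hasProd_eulerProd.map (constantCoeff (R := R)) (continuous_constantCoeff R)
  simp only [Function.comp_def, map_sub, map_one, map_pow, constantCoeff_X, ne_eq,
    Nat.add_eq_zero_iff, one_ne_zero, and_false, not_false_eq_true, zero_pow, sub_zero] at h
  exact h.unique hasProd_one

end InfiniteProducts

section ThetaDissections

variable {A : Type*} [CommRing A]

theorem thetaTerm_three_mul (x y : A) (k : ℤ) :
    thetaTerm x y (3 * k) = thetaTerm (x ^ 6 * y ^ 3) (x ^ 3 * y ^ 6) k := by
  have e1 := two_mul_tri k
  have e2 := two_mul_tri (k - 1)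
  have e3 := two_mul_tri (3 * k)
  have e4 := two_mul_tri (3 * k - 1)
  have h1 : tri (3 * k) = 6 * tri k + 3 * tri (k - 1) := by
    zify
    linarith
  have h2 : tri (3 * k - 1) = 3 * tri k + 6 * tri (k - 1) := by
    zify
    linarith
  rw [thetaTerm, thetaTerm, h1, h2]
  ring

theorem thetaTerm_three_mul_add_one (x y : A) (k : ℤ) :
    thetaTerm x y (3 * k + 1) = x * thetaTerm (x ^ 9 * y ^ 6) (y ^ 3) k := by
  have e1 := two_mul_tri k
  have e2 := two_mul_tri (k - 1)
  have e3 := two_mul_tri (3 * k + 1)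
  have e4 := two_mul_tri (3 * k + 1 - 1)
  have h1 : tri (3 * k + 1) = 1 + 9 * tri k := by
    zify
    linarith
  have h2 : tri (3 * k + 1 - 1) = 6 * tri k + 3 * tri (k - 1) := by
    zify
    linarith
  rw [thetaTerm, thetaTerm, h1, h2]
  ring

theorem thetaTerm_self_two_mul (x : A) (k : ℤ) :
    thetaTerm x x (2 * k) = thetaTerm (x ^ 4) (x ^ 4) k := by
  have e1 := two_mul_tri k
  have e2 := two_mul_tri (k - 1)
  have e3 := two_mul_tri (2 * k)
  have e4 := two_mul_tri (2 * k - 1)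
  have h : tri (2 * k) + tri (2 * k - 1) = 4 * tri k + 4 * tri (k - 1) := by
    zify
    linarith
  rw [thetaTerm, thetaTerm, ← pow_add, h]
  ring

theorem thetaTerm_self_two_mul_add_one (x : A) (k : ℤ) :
    thetaTerm x x (2 * k + 1) = x * thetaTerm 1 (x ^ 8) (-k) := by
  have e1 := two_mul_tri k
  have e3 := two_mul_tri (2 * k + 1)
  have e4 := two_mul_tri (2 * k + 1 - 1)
  have h : tri (2 * k + 1) + tri (2 * k + 1 - 1) = 1 + 8 * tri k := by
    zify
    linarith
  rw [thetaTerm_neg, thetaTerm, thetaTerm, ← pow_add, h]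
  ring

variable [TopologicalSpace A]

theorem HasSum.thetaTerm_swap {x y s : A} (h : HasSum (thetaTerm x y) s) :
    HasSum (thetaTerm y x) s := by
  rw [← (Equiv.neg ℤ).hasSum_iff] at h
  simpa [Function.comp_def, thetaTerm_neg] using h

variable [IsTopologicalRing A] [T2Space A]

theorem HasSum.thetaTerm_dissect_three {x y s a b c : A} (hs : HasSum (thetaTerm x y) s)
    (ha : HasSum (thetaTerm (x ^ 6 * y ^ 3) (x ^ 3 * y ^ 6)) a)
    (hb : HasSum (thetaTerm (x ^ 9 * y ^ 6) (y ^ 3)) b)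
    (hc : HasSum (thetaTerm (y ^ 9 * x ^ 6) (x ^ 3)) c) : s = a + x * b + y * c := by
  have h2 (k : ℤ) : thetaTerm x y (3 * k + 2) =
      y * thetaTerm (x ^ 3) (y ^ 9 * x ^ 6) (k + 1) := by
    rw [← neg_neg (3 * k + 2), thetaTerm_neg, show -(3 * k + 2) = 3 * (-(k + 1)) + 1 by ring,
      thetaTerm_three_mul_add_one, thetaTerm_neg]
  refine hs.unique ?_
  rw [show a + x * b + y * c = ∑ r, ![a, x * b, y * c] r by simp [Fin.sum_univ_three]]
  refine HasSum.of_fintype_prod (Int.divModEquiv 3) fun r ↦ ?_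
  fin_cases r
  · simpa [Int.divModEquiv, mul_comm _ (3 : ℤ), thetaTerm_three_mul] using! ha
  · simpa [Int.divModEquiv, mul_comm _ (3 : ℤ), thetaTerm_three_mul_add_one] using hb.mul_left x
  · have h := ((Equiv.addRight (1 : ℤ)).hasSum_iff.mpr hc.thetaTerm_swap).mul_left y
    simpa [Int.divModEquiv, mul_comm _ (3 : ℤ), h2] using h

theorem HasSum.thetaTerm_dissect_two {x s a b : A} (hs : HasSum (thetaTerm x x) s)
    (ha : HasSum (thetaTerm (x ^ 4) (x ^ 4)) a) (hb : HasSum (thetaTerm 1 (x ^ 8)) b) :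
    s = a + x * b := by
  refine hs.unique ?_
  rw [show a + x * b = ∑ r, ![a, x * b] r by simp]
  refine HasSum.of_fintype_prod (Int.divModEquiv 2) fun r ↦ ?_
  fin_cases r
  · simpa [Int.divModEquiv, mul_comm _ (2 : ℤ), thetaTerm_self_two_mul] using! ha
  · have h := ((Equiv.neg ℤ).hasSum_iff.mpr hb).mul_left x
    simpa [Int.divModEquiv, mul_comm _ (2 : ℤ), thetaTerm_self_two_mul_add_one] using h

end ThetaDissections

section ThetaSeries

variable {R : Type*} [CommRing R] [TopologicalSpace R]

variable (R) in
/-- Ramanujan's `φ(-q)`, in product form. -/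
noncomputable def phiNeg : R⟦X⟧ := oddProd R ^ 2 * dilate 2 (eulerProd R)

variable (R) in
/-- Ramanujan's `φ(q)`, in product form. -/
noncomputable def phi : R⟦X⟧ := rescale (-1) (phiNeg R)

variable (R) in
/-- Ramanujan's `ψ(q)`, in product form. -/
noncomputable def psi : R⟦X⟧ := distinctProd R ^ 2 * eulerProd R

variable (R) in
/-- Ramanujan's theta function `f(q, q²)`, in product form. -/
noncomputable def thetaOneTwo : R⟦X⟧ :=
  (∏' k : ℕ, (1 + X ^ (3 * k + 1))) * (∏' k : ℕ, (1 + X ^ (3 * k + 2))) * dilate 3 (eulerProd R)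

variable (R) in
/-- Ramanujan's theta function `f(-q, -q⁵)`, in product form. -/
noncomputable def thetaNegOneFive : R⟦X⟧ :=
  (∏' k : ℕ, (1 - X ^ (6 * k + 1))) * (∏' k : ℕ, (1 - X ^ (6 * k + 5))) * dilate 6 (eulerProd R)

theorem HasSum.thetaTerm_dilate {x y s : R⟦X⟧} (h : HasSum (thetaTerm x y) s) (k : ℕ) [NeZero k] :
    HasSum (thetaTerm (dilate k x) (dilate k y)) (dilate k s) := by
  simpa [Function.comp_def, thetaTerm] using! h.map (dilate k) (continuous_dilate k)

theorem multipliable_one_add_X_pow_mul_add (k l : ℕ) [NeZero k] :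
    Multipliable fun n : ℕ ↦ (1 + X ^ (k * n + l) : R⟦X⟧) := by
  have hk := NeZero.pos k
  exact multipliable_one_add_of_X_pow_dvd fun n ↦ pow_dvd_pow X (by nlinarith)

theorem multipliable_one_sub_X_pow_mul_add (k l : ℕ) [NeZero k] :
    Multipliable fun n : ℕ ↦ (1 - X ^ (k * n + l) : R⟦X⟧) := by
  have hk := NeZero.pos k
  simp only [sub_eq_add_neg]
  exact multipliable_one_add_of_X_pow_dvd fun n ↦ (pow_dvd_pow X (by nlinarith)).neg_right

variable [DiscreteTopology R]

theorem hasSum_phiNeg : HasSum (thetaTerm (-X) (-X)) (phiNeg R) := by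
  have h1 := hasProd_oddProd (R := R)
  have h2 := hasProd_dilate_eulerProd (R := R) 2
  rw [phiNeg, pow_two]
  refine hasSum_thetaTerm (dvd_neg.mpr dvd_rfl) ?_ ?_ ?_
  · convert! h1 using 2
    ring
  · convert! h1 using 2
    ring
  · convert! h2 using 2
    ring

theorem hasSum_phi : HasSum (thetaTerm X X) (phi R) := by
  have h := (hasSum_phiNeg (R := R)).map (rescale (-1 : R)) (continuous_rescale (-1))
  simpa [Function.comp_def, thetaTerm, rescale_neg_one_X] using! h

theorem hasSum_psi : HasSum (thetaTerm 1 X) (2 * psi R) := by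
  have h1 := hasProd_distinctProd (R := R)
  have h2 := hasProd_eulerProd (R := R)
  rw [psi, show 2 * (distinctProd R ^ 2 * eulerProd R) =
    (2 * distinctProd R) * distinctProd R * eulerProd R by ring]
  refine hasSum_thetaTerm dvd_rfl ?_ ?_ ?_
  · convert! HasProd.zero_mul (f := fun k : ℕ ↦ (1 + X ^ k : R⟦X⟧)) h1 using 2 <;> ring
  · convert! h1 using 2
    ring
  · convert! h2 using 2
    ring

theorem hasSum_thetaOneTwo : HasSum (thetaTerm X (X ^ 2)) (thetaOneTwo R) := by
  refine hasSum_thetaTerm (dvd_pow_self X two_ne_zero) ?_ ?_ ?_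
  · convert! (multipliable_one_add_X_pow_mul_add (R := R) 3 1).hasProd using 2
    ring
  · convert! (multipliable_one_add_X_pow_mul_add (R := R) 3 2).hasProd using 2
    ring
  · convert! hasProd_dilate_eulerProd (R := R) 3 using 2
    ring

theorem hasSum_thetaNegOneFive : HasSum (thetaTerm (-X) (-X ^ 5)) (thetaNegOneFive R) := by
  refine hasSum_thetaTerm (dvd_neg.mpr (dvd_pow_self X (by norm_num))) ?_ ?_ ?_
  · convert! (multipliable_one_sub_X_pow_mul_add (R := R) 6 1).hasProd using 2
    ring
  · convert! (multipliable_one_sub_X_pow_mul_add (R := R) 6 5).hasProd using 2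
    ring
  · convert! hasProd_dilate_eulerProd (R := R) 6 using 2
    ring

theorem thetaOneTwo_mul_dilate :
    thetaOneTwo R * dilate 3 (distinctProd R) = distinctProd R * dilate 3 (eulerProd R) := by
  have h : distinctProd R = (∏' k : ℕ, (1 + X ^ (3 * k + 1))) * (∏' k : ℕ, (1 + X ^ (3 * k + 2))) *
      dilate 3 (distinctProd R) := by
    refine hasProd_distinctProd.unique ?_
    have h := HasProd.of_fintype_prod (Nat.divModEquiv 3)
      (f := fun n : ℕ ↦ (1 + X ^ (n + 1) : R⟦X⟧)) (a := ![∏' k : ℕ, (1 + X ^ (3 * k + 1)),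
        ∏' k : ℕ, (1 + X ^ (3 * k + 2)), dilate 3 (distinctProd R)]) fun r ↦ ?_
    · simpa [Fin.prod_univ_three] using h
    · fin_cases r
      · simpa [Nat.divModEquiv, mul_comm] using
          (multipliable_one_add_X_pow_mul_add (R := R) 3 1).hasProd
      · simpa [Nat.divModEquiv, mul_comm] using
          (multipliable_one_add_X_pow_mul_add (R := R) 3 2).hasProd
      · simpa [Nat.divModEquiv, mul_comm, add_mul, add_assoc] using
          hasProd_dilate_distinctProd (R := R) 3
  rw [thetaOneTwo]
  linear_combination (-dilate 3 (eulerProd R)) * h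

theorem thetaNegOneFive_mul_dilate :
    thetaNegOneFive R * dilate 3 (oddProd R) = oddProd R * dilate 6 (eulerProd R) := by
  have h : oddProd R = (∏' k : ℕ, (1 - X ^ (6 * k + 1))) * (∏' k : ℕ, (1 - X ^ (6 * k + 5))) *
      dilate 3 (oddProd R) := by
    refine hasProd_oddProd.unique ?_
    have h := HasProd.of_fintype_prod (Nat.divModEquiv 3)
      (f := fun n : ℕ ↦ (1 - X ^ (2 * n + 1) : R⟦X⟧)) (a := ![∏' k : ℕ, (1 - X ^ (6 * k + 1)),
        dilate 3 (oddProd R), ∏' k : ℕ, (1 - X ^ (6 * k + 5))]) fun r ↦ ?_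
    · simpa [Fin.prod_univ_three, mul_right_comm] using h
    · fin_cases r
      · convert! (multipliable_one_sub_X_pow_mul_add (R := R) 6 1).hasProd using 3 with n
        simp [Nat.divModEquiv]
        ring
      · convert! hasProd_dilate_oddProd (R := R) 3 using 3 with n
        simp [Nat.divModEquiv]
        ring
      · convert! (multipliable_one_sub_X_pow_mul_add (R := R) 6 5).hasProd using 3 with n
        simp [Nat.divModEquiv]
        ring
  rw [thetaNegOneFive]
  linear_combination (-dilate 6 (eulerProd R)) * h

end ThetaSeries

section ProductRelations

variable {R : Type*} [CommRing R] [TopologicalSpace R]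

theorem phi_eq : phi R = rescale (-1) (oddProd R) ^ 2 * dilate 2 (eulerProd R) := by
  rw [phi, phiNeg, map_mul, map_pow, rescale_neg_one_dilate 2 even_two]

theorem dilate_two_phiNeg :
    dilate 2 (phiNeg R) = dilate 2 (oddProd R) ^ 2 * dilate 4 (eulerProd R) := by
  rw [phiNeg, map_mul, map_pow, dilate_dilate 2 2 4 rfl]

variable [DiscreteTopology R]

theorem isUnit_eulerProd : IsUnit (eulerProd R) := by
  rw [isUnit_iff_constantCoeff, constantCoeff_eulerProd]
  exact isUnit_one

theorem oddProd_mul_distinctProd : oddProd R * distinctProd R = 1 := by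
  apply isUnit_eulerProd.mul_left_cancel
  linear_combination oddProd R * eulerProd_mul_distinctProd (R := R) - eulerProd_eq (R := R)

theorem dilate_oddProd_mul_dilate_distinctProd (k : ℕ) [NeZero k] :
    dilate k (oddProd R) * dilate k (distinctProd R) = 1 := by
  rw [← map_mul, oddProd_mul_distinctProd, map_one]

theorem rescale_oddProd :
    rescale (-1) (oddProd R) = dilate 2 (oddProd R) * distinctProd R := by
  linear_combination distinctProd R * oddProd_mul_rescale (R := R) -
    rescale (-1) (oddProd R) * oddProd_mul_distinctProd (R := R)

theorem rescale_eulerProd :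
    rescale (-1) (eulerProd R) = rescale (-1) (oddProd R) * dilate 2 (eulerProd R) := by
  conv_lhs => rw [eulerProd_eq, map_mul, rescale_neg_one_dilate 2 even_two]

theorem dilate_two_eulerProd :
    dilate 2 (eulerProd R) = dilate 2 (oddProd R) * dilate 4 (eulerProd R) := by
  conv_lhs => rw [eulerProd_eq, map_mul, dilate_dilate 2 2 4 rfl]

theorem psi_eq : psi R = distinctProd R * dilate 2 (eulerProd R) := by
  rw [psi, ← eulerProd_mul_distinctProd]
  ring

theorem dilate_two_psi :
    dilate 2 (psi R) = dilate 2 (distinctProd R) * dilate 4 (eulerProd R) := by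
  rw [psi_eq, map_mul, dilate_dilate 2 2 4 rfl]

theorem phi_mul_phiNeg : phi R * phiNeg R = dilate 2 (phiNeg R) ^ 2 := by
  calc phi R * phiNeg R
      = (oddProd R * rescale (-1) (oddProd R)) ^ 2 * dilate 2 (eulerProd R) ^ 2 := by
        rw [phi_eq, phiNeg]
        ring
    _ = _ := by
        rw [oddProd_mul_rescale, dilate_two_eulerProd, dilate_two_phiNeg]
        ring

theorem phi_mul_dilate_two_psi : phi R * dilate 2 (psi R) = psi R ^ 2 := by
  have h := dilate_oddProd_mul_dilate_distinctProd (R := R) 2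
  rw [phi_eq, dilate_two_psi, psi_eq, rescale_oddProd, dilate_two_eulerProd]
  linear_combination (dilate 2 (oddProd R) ^ 2 * distinctProd R ^ 2 * dilate 4 (eulerProd R) ^ 2) *
    h

theorem psi_mul_phiNeg : psi R * phiNeg R = eulerProd R * dilate 2 (eulerProd R) := by
  rw [psi, phiNeg]
  linear_combination (eulerProd R * dilate 2 (eulerProd R)) *
    (oddProd R * distinctProd R + 1) * oddProd_mul_distinctProd (R := R)

theorem constantCoeff_phiNeg : constantCoeff (phiNeg R) = 1 := by
  have h := congrArg constantCoeff (eulerProd_eq (R := R))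
  simp only [dilate, map_mul, constantCoeff_expand, constantCoeff_eulerProd] at h
  rw [mul_one] at h
  simp [phiNeg, dilate, constantCoeff_eulerProd, h.symm]

theorem constantCoeff_phi : constantCoeff (phi R) = 1 := by
  rw [phi, ← coeff_zero_eq_constantCoeff_apply, coeff_rescale]
  simp [constantCoeff_phiNeg]

theorem isUnit_phiNeg : IsUnit (phiNeg R) := by
  rw [isUnit_iff_constantCoeff, constantCoeff_phiNeg]
  exact isUnit_one

theorem phiNeg_dissect_two : phiNeg R = dilate 4 (phi R) - 2 * X * dilate 8 (psi R) := by
  have h1 := (hasSum_phi (R := R)).thetaTerm_dilate 4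
  have h2 := (hasSum_psi (R := R)).thetaTerm_dilate 8
  have h := (hasSum_phiNeg (R := R)).thetaTerm_dissect_two (a := dilate 4 (phi R))
    (b := dilate 8 (2 * psi R)) (by simpa [Even.neg_pow, Nat.even_iff] using h1)
    (by simpa [Even.neg_pow, Nat.even_iff] using h2)
  rw [map_mul, map_ofNat] at h
  linear_combination h

theorem phi_dissect_two : phi R = dilate 4 (phi R) + 2 * X * dilate 8 (psi R) := by
  have h1 := (hasSum_phi (R := R)).thetaTerm_dilate 4
  have h2 := (hasSum_psi (R := R)).thetaTerm_dilate 8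
  have h := (hasSum_phi (R := R)).thetaTerm_dissect_two (a := dilate 4 (phi R))
    (b := dilate 8 (2 * psi R)) (by simpa using h1) (by simpa using h2)
  rw [map_mul, map_ofNat] at h
  linear_combination h

theorem phiNeg_dissect_three :
    phiNeg R = dilate 9 (phiNeg R) - 2 * X * dilate 3 (thetaNegOneFive R) := by
  have h1 := (hasSum_phiNeg (R := R)).thetaTerm_dilate 9
  have h2 := ((hasSum_thetaNegOneFive (R := R)).thetaTerm_dilate 3).thetaTerm_swap
  have e₁ : (-X : R⟦X⟧) ^ 6 * (-X) ^ 3 = -X ^ 9 := by ring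
  have e₂ : (-X : R⟦X⟧) ^ 3 * (-X) ^ 6 = -X ^ 9 := by ring
  have e₃ : (-X : R⟦X⟧) ^ 9 * (-X) ^ 6 = -(X ^ 3) ^ 5 := by ring
  have e₄ : (-X : R⟦X⟧) ^ 3 = -X ^ 3 := by ring
  have h := (hasSum_phiNeg (R := R)).thetaTerm_dissect_three (a := dilate 9 (phiNeg R))
    (b := dilate 3 (thetaNegOneFive R)) (c := dilate 3 (thetaNegOneFive R))
    (by simpa [e₁, e₂] using h1)
    (by simpa [e₃, e₄] using h2)
    (by simpa [e₃, e₄] using h2)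
  linear_combination h

theorem two_mul_psi_dissect_three :
    2 * psi R = 2 * dilate 3 (thetaOneTwo R) + 2 * X * dilate 9 (psi R) := by
  have h1 := (hasSum_thetaOneTwo (R := R)).thetaTerm_dilate 3
  have h2 := (hasSum_psi (R := R)).thetaTerm_dilate 9
  have h := (hasSum_psi (R := R)).thetaTerm_dissect_three (a := dilate 3 (thetaOneTwo R))
    (b := dilate 3 (thetaOneTwo R)) (c := dilate 9 (2 * psi R))
    (by simpa [← pow_mul] using h1)
    (by simpa [← pow_mul] using h1.thetaTerm_swap)
    (by simpa using h2.thetaTerm_swap)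
  rw [map_mul, map_ofNat] at h
  linear_combination h

end ProductRelations

section Sections

variable {R : Type*} [CommRing R]

theorem exists_coeff_two_mul_add_eq {F u a b : R⟦X⟧} (hu : IsUnit u)
    (h : F * dilate 2 u = dilate 2 a + X * dilate 2 b) :
    (∃ P, P * u = a ∧ ∀ n, coeff (2 * n) F = coeff n P) ∧
      ∃ P, P * u = b ∧ ∀ n, coeff (2 * n + 1) F = coeff n P := by
  obtain ⟨v, hv⟩ := hu.exists_right_inv
  have hv' : dilate 2 u * dilate 2 v = 1 := by rw [← map_mul, hv, map_one]
  have hF : F = X ^ 0 * dilate 2 (a * v) + X ^ 1 * dilate 2 (b * v) := by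
    simp only [map_mul]
    linear_combination dilate 2 v * h - F * hv'
  refine ⟨⟨a * v, by linear_combination a * hv, fun n ↦ ?_⟩,
    ⟨b * v, by linear_combination b * hv, fun n ↦ ?_⟩⟩
  · rw [hF, map_add, ← add_zero (2 * n), coeff_mul_add_X_pow_mul_dilate two_pos two_pos,
      coeff_mul_add_X_pow_mul_dilate one_lt_two two_pos]
    simp
  · rw [hF, map_add, coeff_mul_add_X_pow_mul_dilate two_pos one_lt_two,
      coeff_mul_add_X_pow_mul_dilate one_lt_two one_lt_two]
    simp

theorem exists_coeff_three_mul_add_one_eq {F u a b c : R⟦X⟧} (hu : IsUnit u)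
    (h : F * dilate 3 u = dilate 3 a + X * dilate 3 b + X ^ 2 * dilate 3 c) :
    ∃ P, P * u = b ∧ ∀ n, coeff (3 * n + 1) F = coeff n P := by
  obtain ⟨v, hv⟩ := hu.exists_right_inv
  have hv' : dilate 3 u * dilate 3 v = 1 := by rw [← map_mul, hv, map_one]
  have hF : F = X ^ 0 * dilate 3 (a * v) + X ^ 1 * dilate 3 (b * v) + X ^ 2 * dilate 3 (c * v) := by
    simp only [map_mul]
    linear_combination dilate 3 v * h - F * hv'
  refine ⟨b * v, by linear_combination b * hv, fun n ↦ ?_⟩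
  rw [hF, map_add, map_add]
  repeat rw [coeff_mul_add_X_pow_mul_dilate (by norm_num) (by norm_num)]
  simp

end Sections

section ModThree

theorem three_eq_zero : (3 : (ZMod 3)⟦X⟧) = 0 := by
  have h : C (3 : ZMod 3) = 0 := by
    rw [show (3 : ZMod 3) = 0 from rfl, map_zero]
  rwa [map_ofNat] at h

theorem dilate_three (F : (ZMod 3)⟦X⟧) : dilate 3 F = F ^ 3 := by
  have h := MvPowerSeries.map_frobenius_expand (σ := Unit) (R := ZMod 3) 3 three_ne_zero (f := F)
  rw [ZMod.frobenius_zmod, MvPowerSeries.map_id] at h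
  exact h

theorem phiNeg_dissect_three_zmod : phiNeg (ZMod 3) = dilate 3 (dilate 3 (phiNeg (ZMod 3))) +
    X * dilate 3 (thetaNegOneFive (ZMod 3)) := by
  rw [dilate_dilate 3 3 9 rfl]
  linear_combination phiNeg_dissect_three (R := ZMod 3) -
    X * dilate 3 (thetaNegOneFive (ZMod 3)) * three_eq_zero

theorem psi_dissect_three_zmod : psi (ZMod 3) = dilate 3 (thetaOneTwo (ZMod 3)) +
    X * dilate 3 (dilate 3 (psi (ZMod 3))) := by
  rw [dilate_dilate 3 3 9 rfl]
  linear_combination 2 * two_mul_psi_dissect_three (R := ZMod 3) +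
    (-psi (ZMod 3) + dilate 3 (thetaOneTwo (ZMod 3)) + X * dilate 9 (psi (ZMod 3))) *
      three_eq_zero

theorem thetaOneTwo_zmod :
    thetaOneTwo (ZMod 3) = eulerProd (ZMod 3) ^ 3 * oddProd (ZMod 3) ^ 2 := by
  have h1 := thetaOneTwo_mul_dilate (R := ZMod 3)
  have h2 := oddProd_mul_distinctProd (R := ZMod 3)
  rw [dilate_three, dilate_three] at h1
  generalize thetaOneTwo (ZMod 3) = A at *
  generalize eulerProd (ZMod 3) = f at *
  generalize oddProd (ZMod 3) = O at *
  generalize distinctProd (ZMod 3) = W at *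
  have h3 : O ^ 3 * W ^ 3 = 1 := by rw [← mul_pow, h2, one_pow]
  linear_combination O ^ 3 * h1 - A * h3 + O ^ 2 * f ^ 3 * h2

theorem thetaNegOneFive_zmod : thetaNegOneFive (ZMod 3) =
    dilate 2 (eulerProd (ZMod 3)) ^ 3 * distinctProd (ZMod 3) ^ 2 := by
  have h1 := thetaNegOneFive_mul_dilate (R := ZMod 3)
  have h2 := oddProd_mul_distinctProd (R := ZMod 3)
  rw [← dilate_dilate 3 2 6 rfl, dilate_three, dilate_three] at h1
  generalize thetaNegOneFive (ZMod 3) = A at *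
  generalize dilate 2 (eulerProd (ZMod 3)) = f at *
  generalize oddProd (ZMod 3) = O at *
  generalize distinctProd (ZMod 3) = W at *
  have h3 : O ^ 3 * W ^ 3 = 1 := by rw [← mul_pow, h2, one_pow]
  linear_combination W ^ 3 * h1 - A * h3 + W ^ 2 * f ^ 3 * h2

theorem thetaOneTwo_mul_thetaNegOneFive :
    thetaOneTwo (ZMod 3) * thetaNegOneFive (ZMod 3) = (psi (ZMod 3) * phiNeg (ZMod 3)) ^ 3 := by
  have h := oddProd_mul_distinctProd (R := ZMod 3)
  rw [thetaOneTwo_zmod, thetaNegOneFive_zmod, psi_mul_phiNeg]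
  calc _ = (oddProd (ZMod 3) * distinctProd (ZMod 3)) ^ 2 *
        (eulerProd (ZMod 3) * dilate 2 (eulerProd (ZMod 3))) ^ 3 := by ring
    _ = _ := by rw [h, one_pow, one_mul]

theorem phi_sq_add_phiNeg_sq : phi (ZMod 3) ^ 2 + phiNeg (ZMod 3) ^ 2 =
    2 * dilate 2 (phi (ZMod 3)) ^ 2 := by
  have hp := phi_dissect_two (R := ZMod 3)
  have hm := phiNeg_dissect_two (R := ZMod 3)
  have hpm := phi_mul_phiNeg (R := ZMod 3)
  set φ := phi (ZMod 3)
  set χ := phiNeg (ZMod 3)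
  set H := φ ^ 2 + χ ^ 2 - 2 * dilate 2 φ ^ 2 with hH
  have hs : φ + χ = 2 * dilate 4 φ := by linear_combination hp + hm
  have key : dilate 2 H = H := by
    simp only [hH, map_add, map_sub, map_mul, map_pow, map_ofNat, dilate_dilate 2 2 4 rfl]
    linear_combination (-(φ + χ + 2 * dilate 4 φ)) * hs + 2 * hpm + (dilate 2 φ ^ 2 +
      dilate 2 χ ^ 2 - 2 * dilate 4 φ ^ 2) * three_eq_zero
  have h0 : constantCoeff H = 0 := by
    simp only [hH, φ, χ, dilate, map_sub, map_add, map_mul, map_pow, map_ofNat,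
      constantCoeff_expand, constantCoeff_phi, constantCoeff_phiNeg]
    norm_num
  have hz := eq_C_of_dilate_eq le_rfl key
  rw [h0, map_zero] at hz
  linear_combination hz

theorem phi_sq_dissect_two : phi (ZMod 3) ^ 2 = dilate 2 (phi (ZMod 3)) ^ 2 +
    4 * X * dilate 4 (psi (ZMod 3)) ^ 2 := by
  have hp := phi_dissect_two (R := ZMod 3)
  have hm := phiNeg_dissect_two (R := ZMod 3)
  have h := phi_sq_add_phiNeg_sq
  have h4 := congrArg (dilate 4) (phi_mul_dilate_two_psi (R := ZMod 3))
  simp only [map_mul, map_pow, dilate_dilate 4 2 8 rfl] at h4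
  set φ := phi (ZMod 3)
  set χ := phiNeg (ZMod 3)
  have hs : φ + χ = 2 * dilate 4 φ := by linear_combination hp + hm
  have hd : φ - χ = 4 * X * dilate 8 (psi (ZMod 3)) := by linear_combination hp - hm
  linear_combination 2 * h + 2 * (φ - χ) * hs + 4 * dilate 4 φ * hd + 16 * X * h4 +
    (-φ ^ 2 + dilate 2 φ ^ 2 + 4 * X * dilate 4 (psi (ZMod 3)) ^ 2) * three_eq_zero

theorem phi_pow_four_add : phi (ZMod 3) ^ 4 + X * dilate 2 (psi (ZMod 3)) ^ 4 = 1 := by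
  have h := phi_sq_dissect_two
  have h2 := congrArg (dilate 2) (phi_mul_dilate_two_psi (R := ZMod 3))
  simp only [map_mul, map_pow, dilate_dilate 2 2 4 rfl] at h2
  set φ := phi (ZMod 3)
  set ψ := psi (ZMod 3)
  set G := φ ^ 4 + X * dilate 2 ψ ^ 4 with hG
  have key : dilate 2 G = G := by
    simp only [hG, map_add, map_mul, map_pow, dilate_dilate 2 2 4 rfl, dilate_X]
    linear_combination (-(φ ^ 2 + dilate 2 φ ^ 2 + 4 * X * dilate 4 ψ ^ 2)) * h -
      8 * X * (dilate 2 φ * dilate 4 ψ + dilate 2 ψ ^ 2) * h2 -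
      (5 * X ^ 2 * dilate 4 ψ ^ 4 + 3 * X * dilate 2 ψ ^ 4) * three_eq_zero
  have h0 : constantCoeff G = 1 := by
    simp [hG, φ, constantCoeff_phi]
  have hz := eq_C_of_dilate_eq le_rfl key
  rwa [h0, map_one] at hz

theorem coeff_eq_of_mul_dilate_phiNeg {F : (ZMod 3)⟦X⟧}
    (hF : F * dilate 2 (phiNeg (ZMod 3)) = phi (ZMod 3)) (n : ℕ) :
    coeff (48 * n + 18) F = coeff n (phi (ZMod 3) * psi (ZMod 3) ^ 3) := by
  have hp := phi_dissect_two (R := ZMod 3)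
  have hpm := phi_mul_phiNeg (R := ZMod 3)
  have hsq := phi_sq_dissect_two
  have hG := congrArg (dilate 2) phi_pow_four_add
  have hψ := psi_dissect_three_zmod
  have hχ := phiNeg_dissect_three_zmod
  have hAB := congrArg (dilate 3) thetaOneTwo_mul_thetaNegOneFive
  have hu := isUnit_phiNeg (R := ZMod 3)
  simp only [map_add, map_mul, map_pow, map_one, dilate_dilate 2 2 4 rfl, dilate_X]
    at hG hAB
  set φ := phi (ZMod 3)
  set χ := phiNeg (ZMod 3)
  set ψ := psi (ZMod 3)
  have h8 := three_eq_zero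
  obtain ⟨⟨P, hP, hcP⟩, -⟩ := exists_coeff_two_mul_add_eq (F := F) (u := χ) (a := dilate 2 φ)
    (b := 2 * dilate 4 ψ) hu (by
      simp only [map_mul, map_ofNat, dilate_dilate 2 2 4 rfl, dilate_dilate 2 4 8 rfl]
      linear_combination hF + hp)
  obtain ⟨-, Q, hQ, hcQ⟩ := exists_coeff_two_mul_add_eq (F := P) (u := χ ^ 2)
    (a := dilate 2 φ * φ) (b := 2 * dilate 4 ψ * φ) (hu.pow 2) (by
      simp only [map_mul, map_pow, map_ofNat, dilate_dilate 2 2 4 rfl, dilate_dilate 2 4 8 rfl]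
      linear_combination φ * hP - P * hpm + dilate 2 φ * hp)
  obtain ⟨⟨T, hT, hcT⟩, -⟩ := exists_coeff_two_mul_add_eq (F := Q) (u := χ ^ 4)
    (a := 2 * dilate 2 ψ * dilate 2 φ ^ 3) (b := 16 * X * dilate 2 ψ * dilate 4 ψ ^ 3) (hu.pow 4)
    (by
      simp only [map_mul, map_pow, map_ofNat, dilate_dilate 2 2 4 rfl, dilate_dilate 2 4 8 rfl,
        dilate_X]
      linear_combination φ ^ 2 * hQ - Q * (φ * χ + dilate 2 χ ^ 2) * hpm +
        2 * dilate 4 ψ * (φ ^ 2 + φ * (dilate 4 φ + 2 * X * dilate 8 ψ) +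
          (dilate 4 φ + 2 * X * dilate 8 ψ) ^ 2) * hp +
        4 * X * dilate 4 ψ * dilate 4 φ * dilate 8 ψ * (dilate 4 φ + 2 * X * dilate 8 ψ) * h8)
  obtain ⟨⟨U, hU, hcU⟩, -⟩ := exists_coeff_two_mul_add_eq (F := T) (u := χ ^ 8)
    (a := 2 * ψ * φ ^ 3) (b := 16 * ψ * φ ^ 3 * φ ^ 2 * dilate 2 ψ ^ 2) (hu.pow 8)
    (by
      simp only [map_mul, map_pow, map_ofNat, dilate_dilate 2 2 4 rfl]
      linear_combination φ ^ 4 * hT - T * (φ * χ + dilate 2 χ ^ 2) *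
        ((φ * χ) ^ 2 + dilate 2 χ ^ 4) * hpm + 2 * dilate 2 ψ * dilate 2 φ ^ 3 *
          ((φ ^ 2 + dilate 2 φ ^ 2 + 4 * X * dilate 4 ψ ^ 2) * hsq + hG +
            5 * X ^ 2 * dilate 4 ψ ^ 4 * h8))
  obtain ⟨V, hV, hcV⟩ := exists_coeff_three_mul_add_one_eq (F := U) (u := χ ^ 3)
    (a := 2 * φ * thetaOneTwo (ZMod 3) * dilate 3 χ) (b := φ * ψ ^ 3 * χ ^ 3)
    (c := 2 * φ * thetaNegOneFive (ZMod 3) * dilate 3 ψ) (hu.pow 3)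
    (by
      simp only [map_mul, map_pow, map_ofNat]
      linear_combination U * (dilate 3 χ ^ 2 + dilate 3 χ * χ ^ 3 + χ ^ 6) * dilate_three χ +
        χ * hU - 2 * ψ * χ * dilate_three φ + 2 * dilate 3 φ * (χ * hψ +
          (dilate 3 (thetaOneTwo (ZMod 3)) + X * dilate 3 (dilate 3 ψ)) * hχ) +
        2 * X * dilate 3 φ * (hAB + dilate 3 (dilate 3 χ) * dilate_three (dilate 3 ψ) +
          dilate 3 ψ ^ 3 * dilate_three (dilate 3 χ)) +
        X * dilate 3 φ * (dilate 3 ψ * dilate 3 χ) ^ 3 * h8)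
  have hV' : V = φ * ψ ^ 3 := (hu.pow 3).mul_right_cancel hV
  rw [← hV', ← hcV, ← hcU, ← hcT, ← hcQ, ← hcP]
  congr 2
  ring

theorem coeff_three_mul_add_one_of_mul_dilate_phiNeg {F : (ZMod 3)⟦X⟧}
    (hF : F * dilate 2 (phiNeg (ZMod 3)) = psi (ZMod 3)) (n : ℕ) :
    (-1) ^ n * coeff (3 * n + 1) F = coeff n (phi (ZMod 3) * psi (ZMod 3) ^ 3) := by
  have hψ := psi_dissect_three_zmod
  have hχ := congrArg (dilate 2) phiNeg_dissect_three_zmod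
  simp only [map_add, map_mul, dilate_X, dilate_dilate 2 3 6 rfl, ← dilate_dilate 3 2 6 rfl]
    at hχ
  obtain ⟨P, hP, hcP⟩ := exists_coeff_three_mul_add_one_eq (F := F)
    (u := dilate 2 (phiNeg (ZMod 3)))
    (a := thetaOneTwo (ZMod 3) * dilate 3 (dilate 2 (phiNeg (ZMod 3))) ^ 2 +
      2 * X * dilate 3 (psi (ZMod 3)) * dilate 3 (dilate 2 (phiNeg (ZMod 3))) *
        dilate 2 (thetaNegOneFive (ZMod 3)))
    (b := dilate 3 (psi (ZMod 3)) * dilate 3 (dilate 2 (phiNeg (ZMod 3))) ^ 2 +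
      X * thetaOneTwo (ZMod 3) * dilate 2 (thetaNegOneFive (ZMod 3)) ^ 2)
    (c := 2 * thetaOneTwo (ZMod 3) * dilate 3 (dilate 2 (phiNeg (ZMod 3))) *
        dilate 2 (thetaNegOneFive (ZMod 3)) +
      X * dilate 3 (psi (ZMod 3)) * dilate 2 (thetaNegOneFive (ZMod 3)) ^ 2)
    (isUnit_phiNeg.map _) (by
      simp only [map_add, map_mul, map_pow, map_ofNat, dilate_X]
      generalize dilate 3 (dilate 2 (thetaNegOneFive (ZMod 3))) = b at *
      generalize dilate 3 (dilate 3 (dilate 2 (phiNeg (ZMod 3)))) = c at *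
      generalize dilate 3 (thetaOneTwo (ZMod 3)) = a at *
      generalize dilate 3 (dilate 3 (psi (ZMod 3))) = d at *
      rw [dilate_three]
      linear_combination dilate 2 (phiNeg (ZMod 3)) ^ 2 * (hF + hψ) +
        (a + X * d) * (dilate 2 (phiNeg (ZMod 3)) + c + X ^ 2 * b) * hχ)
  have hWO := oddProd_mul_distinctProd (R := ZMod 3)
  have hO := rescale_oddProd (R := ZMod 3)
  have hf2 := dilate_two_eulerProd (R := ZMod 3)
  have hP' : P * dilate 2 (phiNeg (ZMod 3)) = eulerProd (ZMod 3) ^ 3 * oddProd (ZMod 3) ^ 2 *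
      dilate 4 (eulerProd (ZMod 3)) ^ 2 := by
    have hG := phi_pow_four_add
    rw [phi_eq, dilate_two_psi, hO, hf2] at hG
    rw [hP, dilate_three, dilate_three,
      dilate_two_phiNeg, thetaOneTwo_zmod, thetaNegOneFive_zmod, psi]
    simp only [map_mul, map_pow, dilate_dilate 2 2 4 rfl]
    generalize dilate 2 (oddProd (ZMod 3)) = O₂ at *
    generalize dilate 2 (distinctProd (ZMod 3)) = W₂ at *
    generalize dilate 4 (eulerProd (ZMod 3)) = f₄ at *
    generalize oddProd (ZMod 3) = O at *
    generalize distinctProd (ZMod 3) = W at *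
    generalize eulerProd (ZMod 3) = f at *
    linear_combination f ^ 3 * O ^ 2 * f₄ ^ 2 * hG -
      f ^ 3 * W ^ 6 * O₂ ^ 12 * f₄ ^ 6 * (O * W + 1) * hWO
  have key : rescale (-1) P = phi (ZMod 3) * psi (ZMod 3) ^ 3 := by
    apply (isUnit_phiNeg.map (dilate 2)).mul_right_cancel
    have h := congrArg (rescale (-1)) hP'
    simp only [map_mul, map_pow, rescale_neg_one_dilate 2 even_two,
      rescale_neg_one_dilate 4 (by decide)] at h
    rw [h, rescale_eulerProd, phi_eq, psi_eq, dilate_two_phiNeg, hO, hf2]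
    ring
  rw [hcP, ← key, coeff_rescale]

end ModThree

section GeneratingFunctions

variable {R : Type*} [CommRing R] [TopologicalSpace R]

theorem tsum_X_pow_mul_ite_le_one (i : ℕ) (P : Prop) [Decidable P] (hP : P) :
    ∑' j, (if P ∧ j + 1 ≤ 1 then X ^ ((i + 1) * (j + 1)) else 0 : R⟦X⟧) = X ^ (i + 1) := by
  rw [tsum_eq_single 0 fun j hj ↦ if_neg (by lia)]
  simp [hP]

variable [DiscreteTopology R]

/-- The generating function of partitions in which the multiplicity of each part is constrained. -/
theorem hasProd_powerSeriesMk_card_count (Q : ℕ → ℕ → Prop) [∀ i c, Decidable (Q i c)] :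
    HasProd (fun i ↦ 1 + ∑' j, (if Q (i + 1) (j + 1) then X ^ ((i + 1) * (j + 1)) else 0 : R⟦X⟧))
      (PowerSeries.mk fun n ↦
        (Finset.card {p : n.Partition | ∀ i ∈ p.parts, Q i (p.parts.count i)} : R)) := by
  convert! Nat.Partition.hasProd_genFun (fun i c ↦ if Q i c then (1 : R) else 0) using 1
  · simp [ite_smul]
  · simp_rw [Nat.Partition.genFun, Finset.card_filter, Finsupp.prod, Finset.prod_boole]
    simp

theorem one_add_tsum_X_pow_mul (i : ℕ) :
    (1 + ∑' j, (X ^ ((i + 1) * (j + 1)) : R⟦X⟧)) * (1 - X ^ (i + 1)) = 1 := by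
  have h0 : constantCoeff (X ^ (i + 1) : R⟦X⟧) = 0 := by simp
  have h := (summable_pow_of_constantCoeff_eq_zero h0).tsum_eq_zero_add
  have h' := tsum_pow_mul_one_sub_of_constantCoeff_eq_zero h0
  simp only [pow_zero, ← pow_mul] at h h'
  rw [← h, h']

theorem hasProd_pow_odd :
    HasProd (fun i : ℕ ↦ if Even (i + 1) then 1 else (1 - X ^ (i + 1) : R⟦X⟧)) (oddProd R) := by
  rw [← mul_one (oddProd R)]
  refine HasProd.even_mul_odd ?_ ?_
  · simpa [Nat.even_add_one] using hasProd_oddProd (R := R)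
  · simp [Nat.even_add_one]

theorem powerSeriesMk_ped_mul :
    (PowerSeries.mk fun n ↦ (ped n : R)) * oddProd R = dilate 2 (distinctProd R) := by
  have h := hasProd_powerSeriesMk_card_count (R := R) fun i c ↦ Even i → c ≤ 1
  have hc : ∀ n, ped n = Finset.card {p : n.Partition | ∀ i ∈ p.parts, Even i → p.parts.count i ≤ 1}
      := by
    intro n
    refine Nat.subtype_card _ fun p ↦ ?_
    rw [Finset.mem_filter_univ]
    refine ⟨fun hp i hi ↦ ?_, fun hp i _ ↦ hp i⟩
    by_cases hip : i ∈ p.parts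
    · exact hp i hip hi
    · simp [Multiset.count_eq_zero_of_notMem hip]
  simp only [← hc] at h
  refine (h.mul hasProd_pow_odd).unique ?_
  rw [← one_mul (dilate 2 _)]
  refine HasProd.even_mul_odd ?_ ?_
  · convert! hasProd_one using 2 with k
    have hk : ¬ Even (2 * k + 1) := by simp
    simpa [hk] using one_add_tsum_X_pow_mul (R := R) (2 * k)
  · convert! hasProd_dilate_distinctProd (R := R) 2 using 2 with k
    have hk : Even (2 * k + 1 + 1) := by simp [Nat.even_add_one]
    have h1 := tsum_X_pow_mul_ite_le_one (R := R) (2 * k + 1) True trivial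
    simp only [true_and] at h1
    simp only [hk, if_true, true_implies, mul_one, h1]
    ring

theorem powerSeriesMk_card_oddDistincts :
    (PowerSeries.mk fun n ↦ ((Nat.Partition.oddDistincts n).card : R)) =
      rescale (-1) (oddProd R) := by
  have h := hasProd_powerSeriesMk_card_count (R := R) fun i c ↦ ¬ Even i ∧ c ≤ 1
  have hc : ∀ n, Nat.Partition.oddDistincts n =
      ({p : n.Partition | ∀ i ∈ p.parts, ¬ Even i ∧ p.parts.count i ≤ 1} : Finset _) := by
    intro n
    ext p
    simp only [Nat.Partition.oddDistincts, Nat.Partition.odds, Nat.Partition.restricted,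
      Nat.Partition.distincts, Multiset.nodup_iff_count_le_one, Finset.mem_inter,
      Finset.mem_filter, Finset.mem_univ, true_and]
    refine ⟨fun hp i hi ↦ ⟨hp.1 i hi, hp.2 i⟩, fun hp ↦ ⟨fun i hi ↦ (hp i hi).1, fun i ↦ ?_⟩⟩
    by_cases hip : i ∈ p.parts
    · exact (hp i hip).2
    · simp [Multiset.count_eq_zero_of_notMem hip]
  simp only [← hc] at h
  refine h.unique ?_
  rw [← mul_one (rescale (-1) _)]
  refine HasProd.even_mul_odd ?_ ?_
  · convert! hasProd_rescale_oddProd (R := R) using 2 with k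
    have hk : ¬ Even (2 * k + 1) := by simp
    rw [tsum_X_pow_mul_ite_le_one _ _ hk]
  · convert! hasProd_one using 2 with k
    have hk : Even (2 * k + 1 + 1) := by simp [Nat.even_add_one]
    simp [hk]

theorem powerSeriesMk_card_odds_mul :
    (PowerSeries.mk fun n ↦ ((Nat.Partition.odds n).card : R)) * oddProd R = 1 := by
  have h := hasProd_powerSeriesMk_card_count (R := R) fun i _ ↦ ¬ Even i
  refine (h.mul hasProd_pow_odd).unique ?_
  convert! hasProd_one using 2 with i
  by_cases hi : Even (i + 1)
  · simp [hi]
  · simpa [hi] using one_add_tsum_X_pow_mul (R := R) i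

theorem powerSeriesMk_pbarOdd_mul :
    (PowerSeries.mk fun n ↦ (pbarOdd n : R)) * oddProd R = rescale (-1) (oddProd R) := by
  have h : (PowerSeries.mk fun n ↦ (pbarOdd n : R)) =
      (PowerSeries.mk fun n ↦ ((Nat.Partition.oddDistincts n).card : R)) *
        PowerSeries.mk fun n ↦ ((Nat.Partition.odds n).card : R) := by
    ext n
    simp [coeff_mul, pbarOdd, Finset.Nat.sum_antidiagonal_eq_sum_range_succ_mk]
  rw [h, mul_assoc, powerSeriesMk_card_odds_mul, mul_one, powerSeriesMk_card_oddDistincts]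

end GeneratingFunctions

theorem neg_one_pow_mul_ped_eq_pbarOdd (n : ℕ) :
    (-1) ^ n * (ped (3 * n + 1) : ZMod 3) = (pbarOdd (48 * n + 18) : ZMod 3) := by
  have hWO := oddProd_mul_distinctProd (R := ZMod 3)
  have hWO2 := dilate_oddProd_mul_dilate_distinctProd (R := ZMod 3) 2
  have hO := oddProd_mul_rescale (R := ZMod 3)
  have h1 := coeff_three_mul_add_one_of_mul_dilate_phiNeg
    (F := PowerSeries.mk fun n ↦ (ped n : ZMod 3)) (by
      rw [dilate_two_phiNeg, psi_eq, dilate_two_eulerProd]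
      linear_combination dilate 2 (oddProd (ZMod 3)) ^ 2 * dilate 4 (eulerProd (ZMod 3)) *
        (distinctProd (ZMod 3) * powerSeriesMk_ped_mul (R := ZMod 3) -
          (PowerSeries.mk fun n ↦ (ped n : ZMod 3)) * hWO) +
        dilate 2 (oddProd (ZMod 3)) * distinctProd (ZMod 3) * dilate 4 (eulerProd (ZMod 3)) *
          hWO2) n
  have h2 := coeff_eq_of_mul_dilate_phiNeg
    (F := PowerSeries.mk fun n ↦ (pbarOdd n : ZMod 3)) (by
      rw [dilate_two_phiNeg, phi_eq, dilate_two_eulerProd]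
      linear_combination dilate 2 (oddProd (ZMod 3)) * dilate 4 (eulerProd (ZMod 3)) *
        (rescale (-1) (oddProd (ZMod 3)) * powerSeriesMk_pbarOdd_mul (R := ZMod 3) -
          (PowerSeries.mk fun n ↦ (pbarOdd n : ZMod 3)) * hO)) n
  rwa [← h2, coeff_mk, coeff_mk] at h1

end PedPbarOdd

theorem ped_pbarOdd_congr (n : ℕ) :
    ((-1 : ℤ)) ^ n * ped (3 * n + 1) ≡ (pbarOdd (48 * n + 18) : ℤ) [ZMOD 3] := by
  apply (ZMod.intCast_eq_intCast_iff _ _ 3).mp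
  exact_mod_cast neg_one_pow_mul_ped_eq_pbarOdd n
end

section
/- For all integers n ≥ 0 and α ≥ 0, p̄_o(2^{2α}(24n+9)) ≡ 0 (mod 3). -/
open PowerSeries Finset
open scoped PowerSeries.WithPiTopology

/-- The partial theta series `∑_{|x| ≤ N} (-1)^x q^(x^2)`. -/
noncomputable def thetaPartial {R : Type*} [CommRing R] (q : R) (N : ℕ) : R :=
  ∑ x ∈ Icc (-(N : ℤ)) N, (-1) ^ x.natAbs * q ^ x.natAbs ^ 2

theorem sum_Icc_neg_succ {M : Type*} [AddCommMonoid M] (f : ℤ → M) (N : ℕ) :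
    ∑ x ∈ Icc (-((N + 1 : ℕ) : ℤ)) ((N + 1 : ℕ) : ℤ), f x =
      ∑ x ∈ Icc (-(N : ℤ)) N, f x + (f (N + 1) + f (-(N + 1))) := by
  have h : Icc (-((N + 1 : ℕ) : ℤ)) ((N + 1 : ℕ) : ℤ) =
      insert (-(N + 1) : ℤ) (insert (N + 1 : ℤ) (Icc (-(N : ℤ)) N)) := by
    ext x
    simp only [mem_insert, mem_Icc]
    omega
  rw [h, sum_insert, sum_insert]
  · abel
  · simp
  · simp only [mem_insert, mem_Icc]
    omega

theorem thetaPartial_succ {R : Type*} [CommRing R] (q : R) (N : ℕ) :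
    thetaPartial q (N + 1) =
      thetaPartial q N + 2 * ((-1) ^ (N + 1) * q ^ (N + 1) ^ 2) := by
  have h1 : ((N : ℤ) + 1).natAbs = N + 1 := by omega
  have h2 : (-((N : ℤ) + 1)).natAbs = N + 1 := by omega
  simp only [thetaPartial, sum_Icc_neg_succ, h1, h2]
  ring

/-- A finite form of the Gauss identity `∑ (-1)^x q^(x^2) = ∏ (1 - q^k) / (1 + q^k)`. -/
theorem prod_mul_thetaPartial {R : Type*} [CommRing R] (q : R) (N : ℕ) :
    (∏ k ∈ range N, (1 + q ^ (k + 1))) * thetaPartial q N =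
      ∏ k ∈ range N, (1 - q ^ (k + 1)) +
        2 * ∑ s ∈ range N, (-1) ^ (s + 1) * q ^ ((s + 1) * (N + 1)) *
          (∏ k ∈ Ico (s + 1) N, (1 - q ^ (k + 1))) *
            ∏ k ∈ range s, (1 + q ^ (k + 1)) := by
  induction N with
  | zero => simp [thetaPartial]
  | succ N ih =>
    let V : ℕ → R := fun s ↦ (-1) ^ (s + 1) * q ^ ((s + 1) * (N + 1)) *
      (∏ k ∈ Ico s N, (1 - q ^ (k + 1))) * ∏ k ∈ range s, (1 + q ^ (k + 1))
    have key : ∑ s ∈ range N, (-1) ^ (s + 1) * q ^ ((s + 1) * (N + 1 + 1)) *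
          (∏ k ∈ Ico (s + 1) (N + 1), (1 - q ^ (k + 1))) *
            ∏ k ∈ range s, (1 + q ^ (k + 1)) =
        (1 + q ^ (N + 1)) * ∑ s ∈ range N, (-1) ^ (s + 1) * q ^ ((s + 1) * (N + 1)) *
          (∏ k ∈ Ico (s + 1) N, (1 - q ^ (k + 1))) *
            ∏ k ∈ range s, (1 + q ^ (k + 1)) + (V N - V 0) := by
      rw [← sum_range_sub V N, mul_sum, ← sum_add_distrib]
      refine sum_congr rfl fun s hs ↦ ?_
      have hsN : s < N := mem_range.mp hs
      simp only [V]
      rw [prod_Ico_succ_top (by omega), prod_eq_prod_Ico_succ_bot hsN,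
        prod_range_succ]
      ring
    have hV0 : V 0 = -(q ^ (N + 1) * ∏ k ∈ range N, (1 - q ^ (k + 1))) := by
      simp [V]
    have hVN : V N = (-1) ^ (N + 1) * q ^ (N + 1) ^ 2 *
        ∏ k ∈ range N, (1 + q ^ (k + 1)) := by
      simp [V, sq]
    rw [sum_range_succ, key, hV0, hVN, thetaPartial_succ, prod_range_succ,
      prod_range_succ, Ico_self, prod_empty]
    linear_combination (1 + q ^ (N + 1)) * ih

theorem pow_dvd_prod_mul_thetaPartial_sub {R : Type*} [CommRing R] (q : R) (N : ℕ) :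
    q ^ (N + 1) ∣ (∏ k ∈ range N, (1 + q ^ (k + 1))) * thetaPartial q N -
      ∏ k ∈ range N, (1 - q ^ (k + 1)) := by
  rw [prod_mul_thetaPartial, add_sub_cancel_left]
  refine Dvd.dvd.mul_left (dvd_sum fun s _ ↦ ?_) _
  refine Dvd.dvd.mul_right (Dvd.dvd.mul_right (Dvd.dvd.mul_left (pow_dvd_pow q ?_) _) _) _
  nlinarith

theorem dvd_prod_sub_one {ι A : Type*} [CommRing A] {d : A} {f : ι → A} (s : Finset ι)
    (h : ∀ i ∈ s, d ∣ f i - 1) : d ∣ ∏ i ∈ s, f i - 1 := by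
  classical
  induction s using Finset.induction_on with
  | empty => simp
  | insert i s hi ih =>
    rw [prod_insert hi, show f i * ∏ j ∈ s, f j - 1 =
      (f i - 1) * ∏ j ∈ s, f j + (∏ j ∈ s, f j - 1) by ring]
    exact dvd_add ((h i (mem_insert_self i s)).mul_right _)
      (ih fun j hj ↦ h j (mem_insert_of_mem hj))

theorem X_pow_dvd_sub_prod_range_of_hasProd {R : Type*} [CommRing R] [TopologicalSpace R]
    [T2Space R] {f : ℕ → R⟦X⟧} {a : R⟦X⟧} (h : HasProd f a)
    (hf : ∀ i, X ^ (i + 1) ∣ f i - 1) (n : ℕ) :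
    X ^ (n + 1) ∣ a - ∏ i ∈ range n, f i := by
  rw [X_pow_dvd_iff]
  intro d hd
  rw [map_sub, sub_eq_zero]
  rw [HasProd, WithPiTopology.tendsto_iff_coeff_tendsto] at h
  refine tendsto_nhds_unique (h d) (tendsto_atTop_of_eventually_const (i₀ := range n) ?_)
  intro s hs
  have hdvd : (X : R⟦X⟧) ^ (n + 1) ∣ ∏ i ∈ s \ range n, f i - 1 := by
    refine dvd_prod_sub_one _ fun i hi ↦ (pow_dvd_pow X ?_).trans (hf i)
    simp only [mem_sdiff, mem_range, not_lt] at hi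
    omega
  have h2 := X_pow_dvd_iff.mp (hdvd.mul_right (∏ i ∈ range n, f i)) d hd
  rwa [sub_one_mul, prod_sdiff hs, map_sub, sub_eq_zero] at h2

section PartitionSeries

variable (R : Type*) [CommRing R]

theorem X_pow_dvd_mk_card_odds_mul_prod_sub (n : ℕ) :
    X ^ (n + 1) ∣ (PowerSeries.mk fun n ↦ ((Nat.Partition.odds n).card : R)) *
      (∏ i ∈ range n, if Even i then 1 - X ^ (i + 1) else 1) - 1 := by
  let _ : TopologicalSpace R := ⊥
  have _ : DiscreteTopology R := ⟨rfl⟩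
  have hmul (i : ℕ) : (if ¬ Even (i + 1) then ∑' j : ℕ, X ^ ((i + 1) * j) else 1) *
      (if Even i then 1 - X ^ (i + 1) else 1) = (1 : R⟦X⟧) := by
    by_cases hi : Even i
    · simp only [hi, Nat.even_add_one, not_true_eq_false, not_false_eq_true, if_true, pow_mul]
      exact WithPiTopology.tsum_pow_mul_one_sub_of_constantCoeff_eq_zero (by simp)
    · simp [hi, Nat.even_add_one]
  have h := X_pow_dvd_sub_prod_range_of_hasProd
    (Nat.Partition.hasProd_powerSeriesMk_card_restricted R (¬ Even ·)) (fun i ↦ ?_) n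
  · have h2 := h.mul_right (∏ i ∈ range n, if Even i then 1 - X ^ (i + 1) else 1)
    rwa [sub_mul, ← prod_mul_distrib, prod_congr rfl fun i _ ↦ hmul i, prod_const_one] at h2
  · by_cases hi : Even i
    · have h3 := hmul i
      simp only [hi, if_true] at h3
      exact ⟨_, by linear_combination h3⟩
    · simp [hi, Nat.even_add_one]

theorem X_pow_dvd_mk_card_oddDistincts_sub_prod (n : ℕ) :
    X ^ (n + 1) ∣ (PowerSeries.mk fun n ↦ ((Nat.Partition.oddDistincts n).card : R)) -
      ∏ i ∈ range n, if Even i then 1 + X ^ (i + 1) else 1 := by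
  let _ : TopologicalSpace R := ⊥
  have _ : DiscreteTopology R := ⟨rfl⟩
  refine X_pow_dvd_sub_prod_range_of_hasProd ?_ (fun i ↦ ?_) n
  · convert! Nat.Partition.hasProd_genFun
      (fun i c ↦ if ¬ Even i ∧ c ≤ 1 then (1 : R) else 0) using 1
    · ext1 i
      rw [tsum_eq_single 0 (fun j hj ↦ by simp [hj])]
      by_cases hi : Even i <;> simp [hi, Nat.even_add_one]
    · ext n
      simp only [Nat.Partition.coeff_genFun, coeff_mk, Finsupp.prod, prod_boole, sum_boole]
      congr 2
      ext p
      simp only [Nat.Partition.oddDistincts, Nat.Partition.odds, Nat.Partition.restricted,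
        Nat.Partition.distincts, mem_inter, mem_filter, mem_univ, true_and,
        Multiset.toFinsupp_support, Multiset.mem_toFinset, Multiset.toFinsupp_apply,
        Multiset.nodup_iff_count_le_one]
      grind [Multiset.count_eq_zero]
  · split_ifs <;> simp

theorem mk_pbarOdd :
    (PowerSeries.mk fun n ↦ (pbarOdd n : R)) =
      (PowerSeries.mk fun n ↦ ((Nat.Partition.oddDistincts n).card : R)) *
        PowerSeries.mk fun n ↦ ((Nat.Partition.odds n).card : R) := by
  ext n
  simp [pbarOdd, coeff_mul, Nat.sum_antidiagonal_eq_sum_range_succ_mk]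

theorem X_pow_dvd_mk_pbarOdd_mul_prod_sub_prod (n : ℕ) :
    X ^ (n + 1) ∣ (PowerSeries.mk fun n ↦ (pbarOdd n : R)) *
      (∏ i ∈ range n, if Even i then 1 - X ^ (i + 1) else 1) -
        ∏ i ∈ range n, if Even i then 1 + X ^ (i + 1) else 1 := by
  have h := dvd_add ((X_pow_dvd_mk_card_odds_mul_prod_sub R n).mul_left
    (PowerSeries.mk fun n ↦ ((Nat.Partition.oddDistincts n).card : R)))
    (X_pow_dvd_mk_card_oddDistincts_sub_prod R n)
  rw [mk_pbarOdd]
  convert h using 1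
  ring

end PartitionSeries

theorem prod_range_two_mul_one_add {A : Type*} [CommRing A] (q : A) (M : ℕ) :
    ∏ k ∈ range (2 * M), (1 + (-q) ^ (k + 1)) =
      (∏ k ∈ range (2 * M), if Even k then 1 - q ^ (k + 1) else 1) *
        ∏ k ∈ range M, (1 + (q ^ 2) ^ (k + 1)) := by
  induction M with
  | zero => simp
  | succ M ih =>
    have h : ¬ Even (2 * M + 1) := by simp
    rw [mul_add_one]
    simp only [prod_range_succ, ih, even_two_mul, if_true, h, if_false]
    rw [Odd.neg_pow (by simp), Even.neg_pow (by simp [Nat.even_add_one])]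
    ring

theorem prod_range_two_mul_one_sub {A : Type*} [CommRing A] (q : A) (M : ℕ) :
    ∏ k ∈ range (2 * M), (1 - (-q) ^ (k + 1)) =
      (∏ k ∈ range (2 * M), if Even k then 1 + q ^ (k + 1) else 1) *
        ∏ k ∈ range M, (1 - (q ^ 2) ^ (k + 1)) := by
  induction M with
  | zero => simp
  | succ M ih =>
    have h : ¬ Even (2 * M + 1) := by simp
    rw [mul_add_one]
    simp only [prod_range_succ, ih, even_two_mul, if_true, h, if_false]
    rw [Odd.neg_pow (by simp), Even.neg_pow (by simp [Nat.even_add_one])]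
    ring

theorem pow_dvd_thetaPartial_add_sub {A : Type*} [CommRing A] (q : A) (N k : ℕ) :
    q ^ (N + 1) ∣ thetaPartial q (N + k) - thetaPartial q N := by
  induction k with
  | zero => simp
  | succ k ih =>
    rw [← add_assoc, thetaPartial_succ, add_sub_right_comm]
    refine dvd_add ih (((pow_dvd_pow q ?_).mul_left _).mul_left _)
    exact (by omega : N + 1 ≤ N + k + 1).trans (Nat.le_self_pow two_ne_zero _)

theorem X_pow_dvd_of_dvd_mul {R : Type*} [CommRing R] {n : ℕ} {u f : R⟦X⟧}
    (hu : constantCoeff u = 1) (h : X ^ n ∣ u * f) : X ^ n ∣ f := by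
  have hu' : IsUnit u := isUnit_iff_constantCoeff.mpr (hu ▸ isUnit_one)
  exact (hu'.dvd_mul_left).mp h

theorem X_pow_dvd_mk_pbarOdd_mul_thetaPartial_sub (R : Type*) [CommRing R] (M : ℕ) :
    X ^ (2 * M + 1) ∣ (PowerSeries.mk fun n ↦ (pbarOdd n : R)) *
      thetaPartial (X ^ 2) (2 * M) - thetaPartial (-X) (2 * M) := by
  have h1 := X_pow_dvd_mk_pbarOdd_mul_prod_sub_prod R (2 * M)
  have h2 : (X : R⟦X⟧) ^ (2 * M + 1) ∣
      (∏ k ∈ range M, (1 + (X ^ 2) ^ (k + 1))) * thetaPartial (X ^ 2) (2 * M) -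
        ∏ k ∈ range M, (1 - (X ^ 2) ^ (k + 1)) := by
    have h := dvd_add (pow_dvd_prod_mul_thetaPartial_sub ((X : R⟦X⟧) ^ 2) M)
      ((pow_dvd_thetaPartial_add_sub ((X : R⟦X⟧) ^ 2) M M).mul_left
        (∏ k ∈ range M, (1 + (X ^ 2) ^ (k + 1))))
    rw [← pow_mul] at h
    refine (pow_dvd_pow X (by omega)).trans (h.trans (dvd_of_eq ?_))
    rw [two_mul M]
    ring
  have h3 := pow_dvd_prod_mul_thetaPartial_sub (-X : R⟦X⟧) (2 * M)
  rw [neg_pow, (IsUnit.neg isUnit_one).pow _ |>.mul_left_dvd] at h3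
  refine X_pow_dvd_of_dvd_mul (u := ∏ k ∈ range (2 * M), (1 + (-X) ^ (k + 1)))
    (by simp [map_prod]) ?_
  rw [prod_range_two_mul_one_sub] at h3
  refine (dvd_sub (dvd_add
    (h1.mul_right ((∏ k ∈ range M, (1 + (X ^ 2) ^ (k + 1))) * thetaPartial (X ^ 2) (2 * M)))
    (h2.mul_left (∏ k ∈ range (2 * M), if Even k then 1 + X ^ (k + 1) else 1))) h3).trans
      (dvd_of_eq ?_)
  rw [prod_range_two_mul_one_add]
  ring

theorem thetaPartial_neg {A : Type*} [CommRing A] (q : A) (N : ℕ) :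
    thetaPartial (-q) N = ∑ x ∈ Icc (-(N : ℤ)) N, q ^ x.natAbs ^ 2 := by
  refine sum_congr rfl fun x _ ↦ ?_
  rw [neg_pow q, ← mul_assoc, ← pow_add, Even.neg_one_pow, one_mul]
  rw [sq, ← mul_one_add]
  simpa [add_comm] using Nat.even_mul_succ_self x.natAbs

theorem thetaPartial_X_sq_pow_three (N : ℕ) :
    thetaPartial ((X : (ZMod 3)⟦X⟧) ^ 2) N ^ 3 = thetaPartial (X ^ 6) N := by
  have : CharP (ZMod 3)⟦X⟧ 3 := charP_of_injective_ringHom (C_injective (R := ZMod 3)) 3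
  have : Fact (Nat.Prime 3) := ⟨Nat.prime_three⟩
  rw [thetaPartial, thetaPartial, sum_pow_char]
  refine sum_congr rfl fun x _ ↦ ?_
  rw [mul_pow, ← pow_mul, ← pow_mul, ← pow_mul, ← pow_mul, mul_comm x.natAbs 3, pow_mul (-1)]
  norm_num
  ring

theorem coeff_mul_thetaPartial_X_pow_six {R : Type*} [CommRing R] (f : R⟦X⟧) (N m : ℕ) :
    coeff (3 * m) (f * thetaPartial (X ^ 6) N) =
      coeff m ((PowerSeries.mk fun n ↦ coeff (3 * n) f) * thetaPartial (X ^ 2) N) := by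
  simp only [thetaPartial, mul_sum, map_sum]
  refine sum_congr rfl fun x _ ↦ ?_
  rcases neg_one_pow_eq_or R⟦X⟧ x.natAbs with h | h <;>
  · simp only [h, ← pow_mul, one_mul, neg_mul, mul_neg, map_neg, coeff_mul_X_pow', coeff_mk]
    have h6 : 6 * x.natAbs ^ 2 ≤ 3 * m ↔ 2 * x.natAbs ^ 2 ≤ m := by omega
    simp only [h6]
    rw [show 3 * m - 6 * x.natAbs ^ 2 = 3 * (m - 2 * x.natAbs ^ 2) by omega]

/-- The integer points of the cube `[-N, N]^3`. -/
noncomputable def intCube (N : ℕ) : Finset (ℤ × ℤ × ℤ) :=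
  Icc (-(N : ℤ)) N ×ˢ Icc (-(N : ℤ)) N ×ˢ Icc (-(N : ℤ)) N

theorem mem_intCube {N : ℕ} {x y z : ℤ} :
    (x, y, z) ∈ intCube N ↔ (-N ≤ x ∧ x ≤ N) ∧ (-N ≤ y ∧ y ≤ N) ∧ (-N ≤ z ∧ z ≤ N) := by
  simp [intCube]

theorem sum_intCube {M : Type*} [AddCommMonoid M] (N : ℕ) (f : ℤ × ℤ × ℤ → M) :
    ∑ v ∈ intCube N, f v = ∑ x ∈ Icc (-(N : ℤ)) N, ∑ y ∈ Icc (-(N : ℤ)) N,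
      ∑ z ∈ Icc (-(N : ℤ)) N, f (x, y, z) := by
  simp only [intCube, sum_product]

theorem coeff_neg_one_pow_mul_X_pow {R : Type*} [CommRing R] (k e n : ℕ) :
    coeff k ((-1) ^ e * X ^ n : R⟦X⟧) = if k = n then (-1) ^ e else 0 := by
  rw [show (-1) ^ e * X ^ n = C ((-1) ^ e : R) * X ^ n by simp, coeff_C_mul, coeff_X_pow]
  simp

theorem coeff_thetaPartial_mul_sq (R : Type*) [CommRing R] (N k : ℕ) :
    coeff k (thetaPartial (-X : R⟦X⟧) N * thetaPartial (X ^ 2) N ^ 2) =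
      ∑ v ∈ intCube N with v.1 ^ 2 + 2 * v.2.1 ^ 2 + 2 * v.2.2 ^ 2 = (k : ℤ),
        (-1) ^ (v.2.1.natAbs + v.2.2.natAbs) := by
  rw [thetaPartial_neg, sq, thetaPartial, sum_mul_sum, sum_mul_sum, sum_filter, sum_intCube,
    map_sum]
  refine sum_congr rfl fun x _ ↦ ?_
  rw [map_sum]
  refine sum_congr rfl fun y _ ↦ ?_
  rw [mul_sum, map_sum]
  refine sum_congr rfl fun z _ ↦ ?_
  rw [show (X : R⟦X⟧) ^ x.natAbs ^ 2 * ((-1) ^ y.natAbs * (X ^ 2) ^ y.natAbs ^ 2 *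
      ((-1) ^ z.natAbs * (X ^ 2) ^ z.natAbs ^ 2)) = (-1) ^ (y.natAbs + z.natAbs) *
      X ^ (x.natAbs ^ 2 + 2 * y.natAbs ^ 2 + 2 * z.natAbs ^ 2) by ring,
    coeff_neg_one_pow_mul_X_pow]
  refine if_congr ?_ rfl rfl
  rw [← Int.natCast_inj, eq_comm]
  push_cast
  simp only [sq_abs]

theorem coeff_thetaPartial_mul_mul (R : Type*) [CommRing R] (N k : ℕ) :
    coeff k (thetaPartial (X : R⟦X⟧) N * (thetaPartial (X ^ 2) N * thetaPartial (X ^ 6) N)) =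
      ∑ v ∈ intCube N with v.1 ^ 2 + 2 * v.2.1 ^ 2 + 6 * v.2.2 ^ 2 = (k : ℤ),
        (-1) ^ (v.1.natAbs + v.2.1.natAbs + v.2.2.natAbs) := by
  rw [thetaPartial, thetaPartial, thetaPartial, sum_mul_sum, sum_mul_sum, sum_filter, sum_intCube,
    map_sum]
  refine sum_congr rfl fun x _ ↦ ?_
  rw [map_sum]
  refine sum_congr rfl fun y _ ↦ ?_
  rw [mul_sum, map_sum]
  refine sum_congr rfl fun z _ ↦ ?_
  rw [show (-1) ^ x.natAbs * (X : R⟦X⟧) ^ x.natAbs ^ 2 *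
      ((-1) ^ y.natAbs * (X ^ 2) ^ y.natAbs ^ 2 * ((-1) ^ z.natAbs * (X ^ 6) ^ z.natAbs ^ 2)) =
      (-1) ^ (x.natAbs + y.natAbs + z.natAbs) *
      X ^ (x.natAbs ^ 2 + 2 * y.natAbs ^ 2 + 6 * z.natAbs ^ 2) by ring,
    coeff_neg_one_pow_mul_X_pow]
  refine if_congr ?_ rfl rfl
  rw [← Int.natCast_inj, eq_comm]
  push_cast
  simp only [sq_abs]

theorem Int.neg_le_and_le_of_sq_le {x : ℤ} {N : ℕ} (h : x ^ 2 ≤ N) : -N ≤ x ∧ x ≤ N := by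
  constructor <;> nlinarith [Int.le_self_sq x, Int.le_self_sq (-x)]

/-- Division by `1 + √-2` in `ℤ[√-2]`, on each plane of fixed `z`. -/
theorem sum_sublattice_eq (R : Type*) [CommRing R] {N m : ℕ} (hN : 3 * m ≤ N) :
    ∑ v ∈ intCube N with v.1 ^ 2 + 2 * v.2.1 ^ 2 + 2 * v.2.2 ^ 2 = ((3 * m : ℕ) : ℤ) ∧
        (3 ∣ v.2.2 ∧ 3 ∣ v.1 - v.2.1), ((-1) ^ (v.2.1.natAbs + v.2.2.natAbs) : R) =
      ∑ v ∈ intCube N with v.1 ^ 2 + 2 * v.2.1 ^ 2 + 6 * v.2.2 ^ 2 = (m : ℤ),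
        (-1) ^ (v.1.natAbs + v.2.1.natAbs + v.2.2.natAbs) := by
  have hN' : (3 * m : ℤ) ≤ N := by exact_mod_cast hN
  refine sum_nbij' (fun v ↦ ((v.1 + 2 * v.2.1) / 3, (v.2.1 - v.1) / 3, v.2.2 / 3))
    (fun v ↦ (v.1 - 2 * v.2.1, v.1 + v.2.1, 3 * v.2.2)) ?_ ?_ ?_ ?_ ?_
  · rintro ⟨x, y, z⟩ h
    simp only [mem_filter, mem_intCube] at h ⊢
    obtain ⟨-, hk, ⟨w, rfl⟩, ⟨t, ht⟩⟩ := h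
    obtain rfl : x = y + 3 * t := by omega
    rw [show (y + 3 * t + 2 * y) / 3 = y + t by omega, show (y - (y + 3 * t)) / 3 = -t by omega,
      show 3 * w / 3 = w by omega]
    push_cast at hk
    have hk' : (y + t) ^ 2 + 2 * (-t) ^ 2 + 6 * w ^ 2 = m := by linarith
    refine ⟨⟨?_, ?_, ?_⟩, hk'⟩ <;> apply Int.neg_le_and_le_of_sq_le <;> nlinarith
  · rintro ⟨u, v, w⟩ h
    simp only [mem_filter, mem_intCube] at h ⊢
    obtain ⟨-, hk⟩ := h
    have hk' : (u - 2 * v) ^ 2 + 2 * (u + v) ^ 2 + 2 * (3 * w) ^ 2 = ((3 * m : ℕ) : ℤ) := by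
      push_cast
      linarith
    refine ⟨?_, hk', by omega, by omega⟩
    push_cast at hk'
    refine ⟨?_, ?_, ?_⟩ <;> apply Int.neg_le_and_le_of_sq_le <;> nlinarith
  · rintro ⟨x, y, z⟩ h
    simp only [mem_filter] at h
    simp only [Prod.mk.injEq]
    omega
  · rintro ⟨u, v, w⟩ -
    simp only [Prod.mk.injEq]
    omega
  · rintro ⟨x, y, z⟩ h
    simp only [mem_filter] at h
    refine neg_one_pow_congr ?_
    simp only [Nat.even_iff]
    omega

theorem three_dvd_of_form {x y z n : ℤ} (h : x ^ 2 + 2 * y ^ 2 + 2 * z ^ 2 = 3 * n) :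
    (3 ∣ y ∨ 3 ∣ z) ∧ (3 ∣ y → 3 ∣ z → 3 ∣ x) ∧ (3 ∣ z → 3 ∣ x - y ∨ 3 ∣ x + y) := by
  have key : ∀ a : ℤ, (3 ∣ a ∧ 3 ∣ a ^ 2) ∨ (¬ 3 ∣ a ∧ 3 ∣ a ^ 2 - 1) := fun a ↦ by
    obtain ⟨k, hk | hk | hk⟩ : ∃ k, a = 3 * k ∨ a = 3 * k + 1 ∨ a = 3 * k + 2 :=
      ⟨a / 3, by omega⟩
    · exact .inl ⟨by omega, ⟨3 * k ^ 2, by rw [hk]; ring⟩⟩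
    · exact .inr ⟨by omega, ⟨3 * k ^ 2 + 2 * k, by rw [hk]; ring⟩⟩
    · exact .inr ⟨by omega, ⟨3 * k ^ 2 + 4 * k + 1, by rw [hk]; ring⟩⟩
  have hx := key x
  have hy := key y
  have hz := key z
  generalize x ^ 2 = a at *
  generalize y ^ 2 = b at *
  generalize z ^ 2 = c at *
  have hx3 : x % 3 = 0 ∨ x % 3 = 1 ∨ x % 3 = 2 := by omega
  have hy3 : y % 3 = 0 ∨ y % 3 = 1 ∨ y % 3 = 2 := by omega
  rcases hx3 with h1 | h1 | h1 <;> rcases hy3 with h2 | h2 | h2 <;> omega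

theorem sum_form_eq_sum_sublattice (N m : ℕ) :
    ∑ v ∈ intCube N with v.1 ^ 2 + 2 * v.2.1 ^ 2 + 2 * v.2.2 ^ 2 = ((3 * m : ℕ) : ℤ),
        ((-1) ^ (v.2.1.natAbs + v.2.2.natAbs) : ZMod 3) =
      ∑ v ∈ intCube N with v.1 ^ 2 + 2 * v.2.1 ^ 2 + 2 * v.2.2 ^ 2 = ((3 * m : ℕ) : ℤ) ∧
        (3 ∣ v.2.2 ∧ 3 ∣ v.1 - v.2.1), (-1) ^ (v.2.1.natAbs + v.2.2.natAbs) := by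
  let w : ℤ × ℤ × ℤ → ZMod 3 := fun v ↦ (-1) ^ (v.2.1.natAbs + v.2.2.natAbs)
  set S := (intCube N).filter
    fun v ↦ v.1 ^ 2 + 2 * v.2.1 ^ 2 + 2 * v.2.2 ^ 2 = ((3 * m : ℕ) : ℤ) with hS
  have hswap : ∑ v ∈ S, (if 3 ∣ v.2.1 then w v else 0) =
      ∑ v ∈ S, if 3 ∣ v.2.2 then w v else 0 := by
    refine sum_nbij' (fun v ↦ (v.1, v.2.2, v.2.1)) (fun v ↦ (v.1, v.2.2, v.2.1)) ?_ ?_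
      (fun _ _ ↦ rfl) (fun _ _ ↦ rfl) (fun v _ ↦ by simp only [w, add_comm]) <;>
    · rintro ⟨x, y, z⟩ h
      simp only [hS, mem_filter, mem_intCube] at h ⊢
      exact ⟨⟨h.1.1, h.1.2.2, h.1.2.1⟩, by rw [← h.2]; ring⟩
  have hneg : ∑ v ∈ S, (if 3 ∣ v.2.2 ∧ 3 ∣ v.1 + v.2.1 then w v else 0) =
      ∑ v ∈ S, if 3 ∣ v.2.2 ∧ 3 ∣ v.1 - v.2.1 then w v else 0 := by
    refine sum_nbij' (fun v ↦ (v.1, -v.2.1, v.2.2)) (fun v ↦ (v.1, -v.2.1, v.2.2)) ?_ ?_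
      (fun _ _ ↦ by simp) (fun _ _ ↦ by simp) (fun v _ ↦ by simp [w]) <;>
    · rintro ⟨x, y, z⟩ h
      simp only [hS, mem_filter, mem_intCube] at h ⊢
      exact ⟨⟨h.1.1, by omega, h.1.2.2⟩, by rw [← h.2]; ring⟩
  have hyz : ∑ v ∈ S, w v = ∑ v ∈ S, (if 3 ∣ v.2.1 then w v else 0) +
      ∑ v ∈ S, (if 3 ∣ v.2.2 then w v else 0) -
      ∑ v ∈ S, (if 3 ∣ v.1 ∧ 3 ∣ v.2.1 ∧ 3 ∣ v.2.2 then w v else 0) := by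
    rw [← sum_add_distrib, ← sum_sub_distrib]
    refine sum_congr rfl fun v hv ↦ ?_
    have h := three_dvd_of_form ((mem_filter.mp hv).2.trans (by push_cast; rfl))
    by_cases h1 : 3 ∣ v.2.1 <;> by_cases h2 : 3 ∣ v.2.2 <;> simp_all
  have hz : ∑ v ∈ S, (if 3 ∣ v.2.2 then w v else 0) =
      ∑ v ∈ S, (if 3 ∣ v.2.2 ∧ 3 ∣ v.1 - v.2.1 then w v else 0) +
      ∑ v ∈ S, (if 3 ∣ v.2.2 ∧ 3 ∣ v.1 + v.2.1 then w v else 0) -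
      ∑ v ∈ S, (if 3 ∣ v.1 ∧ 3 ∣ v.2.1 ∧ 3 ∣ v.2.2 then w v else 0) := by
    rw [← sum_add_distrib, ← sum_sub_distrib]
    refine sum_congr rfl fun v hv ↦ ?_
    have h := three_dvd_of_form ((mem_filter.mp hv).2.trans (by push_cast; rfl))
    have h4 : 3 ∣ v.1 ∧ 3 ∣ v.2.1 ↔ 3 ∣ v.1 - v.2.1 ∧ 3 ∣ v.1 + v.2.1 := by omega
    simp only [← and_assoc, h4]
    by_cases h1 : 3 ∣ v.2.2 <;> by_cases h2 : 3 ∣ v.1 - v.2.1 <;>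
      by_cases h3 : 3 ∣ v.1 + v.2.1 <;> simp_all
  conv_rhs => rw [← filter_filter, ← hS, sum_filter]
  change ∑ v ∈ S, w v = ∑ v ∈ S, if 3 ∣ v.2.2 ∧ 3 ∣ v.1 - v.2.1 then w v else 0
  have h3 : (3 : ZMod 3) = 0 := rfl
  rw [hyz, hswap, hz, hneg]
  linear_combination (∑ v ∈ S, (if 3 ∣ v.2.2 ∧ 3 ∣ v.1 - v.2.1 then w v else 0) -
    ∑ v ∈ S, (if 3 ∣ v.1 ∧ 3 ∣ v.2.1 ∧ 3 ∣ v.2.2 then w v else 0)) * h3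

theorem constantCoeff_thetaPartial_X_sq (R : Type*) [CommRing R] (N : ℕ) :
    constantCoeff (thetaPartial (X ^ 2 : R⟦X⟧) N) = 1 := by
  rw [thetaPartial, map_sum, sum_eq_single 0] <;> simp +contextual

theorem pbarOdd_three_mul_eq_coeff (m : ℕ) :
    (pbarOdd (3 * m) : ZMod 3) =
      coeff m (thetaPartial X (6 * m) * thetaPartial (X ^ 6) (6 * m)) := by
  set P : (ZMod 3)⟦X⟧ := PowerSeries.mk fun n ↦ (pbarOdd n : ZMod 3)
  set N := 6 * m with hN
  have h1 : X ^ (N + 1) ∣ P * thetaPartial (X ^ 6) N -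
      thetaPartial (-X) N * thetaPartial (X ^ 2) N ^ 2 := by
    have h := (X_pow_dvd_mk_pbarOdd_mul_thetaPartial_sub (ZMod 3) (3 * m)).mul_right
      (thetaPartial (X ^ 2) N ^ 2)
    rw [show 2 * (3 * m) = N by omega] at h
    rw [← thetaPartial_X_sq_pow_three]
    convert h using 1
    ring
  have h2 : X ^ (m + 1) ∣ thetaPartial (X ^ 2) N *
      ((PowerSeries.mk fun n ↦ coeff (3 * n) P) - thetaPartial X N * thetaPartial (X ^ 6) N) := by
    rw [X_pow_dvd_iff]
    intro d hd
    have h3 := X_pow_dvd_iff.mp h1 (3 * d) (by omega)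
    rw [map_sub, coeff_mul_thetaPartial_X_pow_six, coeff_thetaPartial_mul_sq,
      sum_form_eq_sum_sublattice, sum_sublattice_eq (ZMod 3) (by omega),
      ← coeff_thetaPartial_mul_mul, ← map_sub] at h3
    rw [← h3]
    congr 1
    ring
  have h4 := X_pow_dvd_iff.mp
    (X_pow_dvd_of_dvd_mul (constantCoeff_thetaPartial_X_sq (ZMod 3) N) h2) m (by omega)
  rwa [map_sub, coeff_mk, coeff_mk, sub_eq_zero] at h4

theorem pbarOdd_three_mul_modEq_zero {m : ℕ} (h : ∀ x y : ℕ, x ^ 2 + 6 * y ^ 2 ≠ m) :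
    pbarOdd (3 * m) ≡ 0 [MOD 3] := by
  rw [← ZMod.natCast_eq_natCast_iff, pbarOdd_three_mul_eq_coeff, thetaPartial, thetaPartial,
    sum_mul_sum, map_sum, Nat.cast_zero]
  refine sum_eq_zero fun x _ ↦ ?_
  rw [map_sum]
  refine sum_eq_zero fun y _ ↦ ?_
  rw [show (-1) ^ x.natAbs * (X : (ZMod 3)⟦X⟧) ^ x.natAbs ^ 2 *
      ((-1) ^ y.natAbs * (X ^ 6) ^ y.natAbs ^ 2) =
      (-1) ^ (x.natAbs + y.natAbs) * X ^ (x.natAbs ^ 2 + 6 * y.natAbs ^ 2) by ring,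
    coeff_neg_one_pow_mul_X_pow, if_neg (h _ _).symm]

theorem sq_add_six_mul_sq_ne (n α x y : ℕ) :
    x ^ 2 + 6 * y ^ 2 ≠ 2 ^ (2 * α) * (8 * n + 3) := by
  induction α generalizing x y with
  | zero =>
    intro h
    rcases Nat.even_or_odd' x with ⟨a, rfl | rfl⟩ <;>
    rcases Nat.even_or_odd' y with ⟨b, rfl | rfl⟩ <;>
    · obtain ⟨t, ht⟩ := Nat.even_mul_succ_self a
      ring_nf at h ht
      omega
  | succ α ih =>
    intro h
    rw [show 2 ^ (2 * (α + 1)) * (8 * n + 3) = 4 * (2 ^ (2 * α) * (8 * n + 3)) by ring] at h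
    rcases Nat.even_or_odd' x with ⟨a, rfl | rfl⟩ <;>
    rcases Nat.even_or_odd' y with ⟨b, rfl | rfl⟩
    · exact ih a b (by linarith)
    all_goals
      exfalso
      generalize 2 ^ (2 * α) * (8 * n + 3) = k at h
      ring_nf at h
      omega

theorem pbarOdd_cong_24_9 (n α : ℕ) :
    pbarOdd (2 ^ (2 * α) * (24 * n + 9)) ≡ 0 [MOD 3] := by
  rw [show 2 ^ (2 * α) * (24 * n + 9) = 3 * (2 ^ (2 * α) * (8 * n + 3)) by ring]
  exact pbarOdd_three_mul_modEq_zero fun x y ↦ sq_add_six_mul_sq_ne n α x y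
end
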